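/- arXiv:2106.14759 — 2 statements merged into one kernel-verified Lean document; each statement's English description precedes it below -/
import Mathlib

section
/- (Minimal Growth) Let a = (a_1,…,a_r) be a degree sequence with pure-powers ideal 𝔞, and let I ⊆ A = K[x_1,…,x_n] be a homogeneous ideal containing 𝔞. Let L be the a-lpp ideal with the same Hilbert function as I (which exists by the Clements–Lindström theorem). Then H(𝔪·L + 𝔞) ≤ H(𝔪·I + 𝔞), i.e. dim_K (𝔪L + 𝔞)_d ≤ dim_K (𝔪I + 𝔞)_d for all d ≥ 0. -/
open MvPolynomial

section Defs

variable {K : Type*} [Field K]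

/-- Total degree of an exponent vector. -/
def expDeg {n : ℕ} (m : Fin n →₀ ℕ) : ℕ := ∑ i, m i

/-- `lexLe m m'` means `m ≤ m'` in the lexicographic order with `x_1 > x_2 > … > x_n`. -/
def lexLe {n : ℕ} (m m' : Fin n →₀ ℕ) : Prop :=
  m = m' ∨ ∃ i : Fin n, (∀ j : Fin n, j < i → m j = m' j) ∧ m i < m' i

/-- A lex-segment in degree `d`: an upward (w.r.t. lex) closed set of degree-`d`
exponent vectors. -/
def IsLexSegment (n d : ℕ) (S : Set (Fin n →₀ ℕ)) : Prop :=
  (∀ m ∈ S, expDeg m = d) ∧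
    ∀ m ∈ S, ∀ m' : Fin n →₀ ℕ, expDeg m' = d → lexLe m m' → m' ∈ S

/-- The pure-powers ideal `(x_1^{a_1}, …, x_r^{a_r})`. -/
noncomputable def purePowers (K : Type*) [Field K] {n r : ℕ} (hrn : r ≤ n)
    (a : Fin r → ℕ) : Ideal (MvPolynomial (Fin n) K) :=
  Ideal.span (Set.range fun i : Fin r => X (Fin.castLE hrn i) ^ a i)

/-- A homogeneous ideal. -/
def IsHomog {n : ℕ} (I : Ideal (MvPolynomial (Fin n) K)) : Prop :=
  ∀ f ∈ I, ∀ d : ℕ, homogeneousComponent d f ∈ I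

/-- The degree-`d` component of an ideal, as a `K`-subspace. -/
noncomputable def component {n : ℕ} (I : Ideal (MvPolynomial (Fin n) K)) (d : ℕ) :
    Submodule K (MvPolynomial (Fin n) K) :=
  Submodule.restrictScalars K I ⊓ homogeneousSubmodule (Fin n) K d

/-- Hilbert function of an ideal: `dim_K I_d`. -/
noncomputable def hilb {n : ℕ} (I : Ideal (MvPolynomial (Fin n) K)) (d : ℕ) : ℕ :=
  Module.finrank K ↥(component I d)

/-- An `a`-lpp (lex-plus-powers) ideal: a homogeneous (monomial) ideal each of whose graded
components is the span of a lex-segment plus the corresponding component of the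
pure-powers ideal. -/
def IsLPP {n r : ℕ} (hrn : r ≤ n) (a : Fin r → ℕ)
    (J : Ideal (MvPolynomial (Fin n) K)) : Prop :=
  IsHomog J ∧
    ∀ d : ℕ, ∃ S : Set (Fin n →₀ ℕ), IsLexSegment n d S ∧
      component J d =
        Submodule.span K ((fun m => (monomial m (1 : K) : MvPolynomial (Fin n) K)) '' S)
          ⊔ component (purePowers K hrn a) d

/-- `I` satisfies `EGH_a(d)`. -/
def EGHd {n r : ℕ} (hrn : r ≤ n) (a : Fin r → ℕ)
    (I : Ideal (MvPolynomial (Fin n) K)) (d : ℕ) : Prop :=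
  ∃ J : Ideal (MvPolynomial (Fin n) K), IsLPP hrn a J ∧
    hilb J d = hilb I d ∧ hilb J (d + 1) ≤ hilb I (d + 1)

/-- `I` satisfies `EGH_a`. -/
def EGH {n r : ℕ} (hrn : r ≤ n) (a : Fin r → ℕ)
    (I : Ideal (MvPolynomial (Fin n) K)) : Prop :=
  ∀ d : ℕ, EGHd hrn a I d

/-- A monomial ideal. -/
def IsMonomialIdeal {n : ℕ} (I : Ideal (MvPolynomial (Fin n) K)) : Prop :=
  ∃ M : Set (Fin n →₀ ℕ),
    I = Ideal.span ((fun m => (monomial m (1 : K) : MvPolynomial (Fin n) K)) '' M)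

/-- A strongly stable (monomial) ideal. -/
def IsStronglyStable {n : ℕ} (S : Ideal (MvPolynomial (Fin n) K)) : Prop :=
  IsMonomialIdeal S ∧
    ∀ (m : Fin n →₀ ℕ) (i j : Fin n), j ≤ i →
      (monomial (m + Finsupp.single i 1) (1 : K) : MvPolynomial (Fin n) K) ∈ S →
      (monomial (m + Finsupp.single j 1) (1 : K) : MvPolynomial (Fin n) K) ∈ S

/-- An `a`-spp (strongly-stable-plus-powers) ideal. -/
def IsSPP {n r : ℕ} (hrn : r ≤ n) (a : Fin r → ℕ)
    (J : Ideal (MvPolynomial (Fin n) K)) : Prop :=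
  ∃ S : Ideal (MvPolynomial (Fin n) K), IsStronglyStable S ∧ J = S ⊔ purePowers K hrn a

/-- A regular sequence: each `f i` is a non-zerodivisor modulo `(f j : j < i)`. -/
def IsRegSeq {n r : ℕ} (f : Fin r → MvPolynomial (Fin n) K) : Prop :=
  ∀ i : Fin r, ∀ g : MvPolynomial (Fin n) K,
    g * f i ∈ Ideal.span { p | ∃ j : Fin r, j < i ∧ p = f j } →
    g ∈ Ideal.span { p | ∃ j : Fin r, j < i ∧ p = f j }

/-- `I` contains a homogeneous regular sequence of degree `a`. -/
def ContainsRegSeq {n r : ℕ} (a : Fin r → ℕ)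
    (I : Ideal (MvPolynomial (Fin n) K)) : Prop :=
  ∃ f : Fin r → MvPolynomial (Fin n) K,
    (∀ i, f i ∈ I) ∧ IsRegSeq f ∧ ∀ i, (f i).IsHomogeneous (a i)

/-- `dim_K (N/P)` for ideals `P ≤ N` (the `K`-dimension of `N/(N ∩ P)`). -/
noncomputable def quotDim (K : Type*) [Field K] {n : ℕ}
    (N P : Ideal (MvPolynomial (Fin n) K)) : ℕ :=
  Module.finrank K
    (↥(Submodule.restrictScalars K N) ⧸
      Submodule.comap (Submodule.restrictScalars K N).subtype (Submodule.restrictScalars K P))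

/-- `dim_K (I/F)_d`. -/
noncomputable def relHilb {n : ℕ} (I F : Ideal (MvPolynomial (Fin n) K)) (d : ℕ) : ℕ :=
  Module.finrank K
    (↥(component I d) ⧸ Submodule.comap (component I d).subtype (Submodule.restrictScalars K F))

/-- `dim_K (A/I)_d`. -/
noncomputable def hilbQ {n : ℕ} (I : Ideal (MvPolynomial (Fin n) K)) (d : ℕ) : ℕ :=
  Module.finrank K
    (↥(homogeneousSubmodule (Fin n) K d) ⧸
      Submodule.comap (homogeneousSubmodule (Fin n) K d).subtype (Submodule.restrictScalars K I))

end Defs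

section Shadow

variable {ι : Type*}

theorem eq_of_le_of_sum_eq [Fintype ι] {m m' : ι → ℕ} (h : ∀ i, m i ≤ m' i)
    (hs : ∑ i, m i = ∑ i, m' i) : m = m' := by
  funext i
  exact (Finset.sum_eq_sum_iff_of_le fun i _ => h i).1 hs i (Finset.mem_univ i)

variable [LinearOrder ι]

theorem toLex_lt_iff {m m' : ι → ℕ} :
    toLex m < toLex m' ↔ ∃ i, (∀ j, j < i → m j = m' j) ∧ m i < m' i :=
  Iff.rfl

theorem add_single_injective (i : ι) :
    Function.Injective fun m : ι → ℕ => m + Pi.single i 1 :=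
  add_left_injective _

theorem exists_add_single {u : ι → ℕ} {i : ι} (h : 0 < u i) :
    ∃ m : ι → ℕ, m + Pi.single i 1 = u := by
  refine ⟨Function.update u i (u i - 1), ?_⟩
  funext q
  by_cases hq : q = i
  · subst hq; simp; omega
  · simp [hq]

theorem exists_strictAnti_weight (P : Finset (ι → ℕ)) :
    ∃ w : (ι → ℕ) → ℕ, ∀ m ∈ P, ∀ m' ∈ P, toLex m < toLex m' → w m' < w m := by
  classical
  refine ⟨fun m => (P.filter fun m' => toLex m < toLex m').card, fun m _ m' hm' hlt => ?_⟩
  refine Finset.card_lt_card ((Finset.ssubset_iff_of_subset fun x hx => ?_).2 ⟨m', ?_, ?_⟩)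
  · rw [Finset.mem_filter] at hx ⊢
    exact ⟨hx.1, hlt.trans hx.2⟩
  · exact Finset.mem_filter.2 ⟨hm', hlt⟩
  · exact fun h => lt_irrefl _ (Finset.mem_filter.1 h).2

theorem toLex_add_single_lt {m : ι → ℕ} {i j : ι} (h : i < j) :
    toLex (m + Pi.single j 1) < toLex (m + Pi.single i 1) := by
  refine toLex_lt_iff.2 ⟨i, fun x hx => ?_, ?_⟩
  · simp [hx.ne, (hx.trans h).ne]
  · simp [h.ne]

variable [Fintype ι]

/-- The vectors `m ≤ b` of total degree `d` that agree with `z` outside `S`. -/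
def boxLevel (b : ι → ℕ) (S : Finset ι) (z : ι → ℕ) (d : ℕ) : Finset (ι → ℕ) :=
  (Finset.Icc 0 b).filter fun m => (∀ i, i ∉ S → m i = z i) ∧ ∑ i, m i = d

/-- The upper shadow of `B` in the box bounded by `b`, in the directions of `S`. -/
def upShadow (b : ι → ℕ) (S : Finset ι) (B : Finset (ι → ℕ)) : Finset (ι → ℕ) :=
  S.biUnion fun i => (B.filter fun m => m i < b i).image fun m => m + Pi.single i 1

/-- `L` is an initial segment of `P` for the decreasing lexicographic order. -/
def IsInitSeg (P L : Finset (ι → ℕ)) : Prop :=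
  L ⊆ P ∧ ∀ m ∈ L, ∀ m' ∈ P, toLex m < toLex m' → m' ∈ L

theorem mem_boxLevel {b : ι → ℕ} {S : Finset ι} {z : ι → ℕ} {d : ℕ} {m : ι → ℕ} :
    m ∈ boxLevel b S z d ↔ (∀ i, m i ≤ b i) ∧ (∀ i, i ∉ S → m i = z i) ∧ ∑ i, m i = d := by
  simp [boxLevel, Pi.le_def]

theorem mem_upShadow {b : ι → ℕ} {S : Finset ι} {B : Finset (ι → ℕ)} {u : ι → ℕ} :
    u ∈ upShadow b S B ↔ ∃ i ∈ S, ∃ m ∈ B, m i < b i ∧ m + Pi.single i 1 = u := by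
  simp [upShadow, and_assoc]

theorem sum_add_single (m : ι → ℕ) (i : ι) :
    ∑ j, (m + Pi.single i 1 : ι → ℕ) j = ∑ j, m j + 1 := by
  simp [Finset.sum_add_distrib]

theorem toLex_lt_or {m m' : ι → ℕ} (h : m ≠ m') :
    toLex m < toLex m' ∨ toLex m' < toLex m :=
  lt_or_gt_of_ne fun e => h (toLex.injective e)

theorem IsInitSeg.subset_of_card_le {P C D : Finset (ι → ℕ)} (hC : IsInitSeg P C)
    (hD : IsInitSeg P D) (h : C.card ≤ D.card) : C ⊆ D := by
  intro u hu
  by_contra huD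
  have hDC : D ⊆ C := by
    intro v hv
    have hne : u ≠ v := fun e => huD (e ▸ hv)
    rcases toLex_lt_or hne with hlt | hlt
    · exact hC.2 u hu v (hD.1 hv) hlt
    · exact absurd (hD.2 v hv u (hC.1 hu) hlt) huD
  have := Finset.eq_of_subset_of_card_le hDC h
  exact huD (this ▸ hu)

theorem exists_isInitSeg (P : Finset (ι → ℕ)) (k : ℕ) (hk : k ≤ P.card) :
    ∃ C, IsInitSeg P C ∧ C.card = k := by
  induction k with
  | zero => exact ⟨∅, ⟨by simp, by simp⟩, rfl⟩
  | succ k ih =>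
    obtain ⟨C, hC, hcard⟩ := ih (by omega)
    have hne : (P \ C).Nonempty := by
      rw [Finset.sdiff_nonempty]
      intro h
      have := Finset.card_le_card h
      omega
    obtain ⟨x, hx, hmax⟩ := Finset.exists_max_image (P \ C) toLex hne
    rw [Finset.mem_sdiff] at hx
    refine ⟨insert x C, ⟨?_, ?_⟩, ?_⟩
    · exact Finset.insert_subset hx.1 hC.1
    · intro m hm m' hm' hlt
      rw [Finset.mem_insert] at hm ⊢
      rcases hm with rfl | hm
      · by_contra hcon
        push Not at hcon
        exact absurd (hmax m' (Finset.mem_sdiff.2 ⟨hm', hcon.2⟩)) (not_le.2 hlt)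
      · exact Or.inr (hC.2 m hm m' hm' hlt)
    · rw [Finset.card_insert_of_notMem hx.2, hcard]

theorem IsInitSeg.sum_lt {P B C : Finset (ι → ℕ)} (w : (ι → ℕ) → ℕ)
    (hw : ∀ m ∈ P, ∀ m' ∈ P, toLex m < toLex m' → w m' < w m) (hC : IsInitSeg P C)
    (hB : B ⊆ P) (hcard : C.card = B.card) (hne : C ≠ B) : ∑ m ∈ C, w m < ∑ m ∈ B, w m := by
  have h1 : (C \ B).card = (B \ C).card := Finset.card_sdiff_comm hcard
  have hnon : (C \ B).Nonempty := by
    rw [Finset.sdiff_nonempty]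
    exact fun h => hne (Finset.eq_of_subset_of_card_le h hcard.ge)
  obtain ⟨x, hx, hmax⟩ := Finset.exists_max_image (C \ B) w hnon
  have hlt : ∀ y ∈ B \ C, w x + 1 ≤ w y := by
    intro y hy
    rw [Finset.mem_sdiff] at hx hy
    have hxy : x ≠ y := fun e => hx.2 (e ▸ hy.1)
    rcases toLex_lt_or hxy with h | h
    · exact absurd (hC.2 x hx.1 y (hB hy.1) h) hy.2
    · exact hw y (hB hy.1) x (hC.1 hx.1) h
  have h2 := Finset.sum_le_card_nsmul (C \ B) w (w x) hmax
  have h3 := Finset.card_nsmul_le_sum (B \ C) w (w x + 1) hlt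
  have h4 : 0 < (B \ C).card := h1 ▸ hnon.card_pos
  have h5 := Finset.sum_inter_add_sum_sdiff C B w
  have h6 := Finset.sum_inter_add_sum_sdiff B C w
  rw [Finset.inter_comm] at h6
  rw [smul_eq_mul] at h2 h3
  rw [h1] at h2
  nlinarith

theorem isInitSeg_upShadow {b : ι → ℕ} {S : Finset ι} {z : ι → ℕ} {d : ℕ}
    {L : Finset (ι → ℕ)} (hL : IsInitSeg (boxLevel b S z d) L) :
    IsInitSeg (boxLevel b S z (d + 1)) (upShadow b S L) := by
  refine ⟨?_, ?_⟩
  · intro u hu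
    obtain ⟨i, hi, m, hm, hlt, rfl⟩ := mem_upShadow.1 hu
    have h := mem_boxLevel.1 (hL.1 hm)
    refine mem_boxLevel.2 ⟨fun j => ?_, fun j hj => ?_, ?_⟩
    · by_cases hji : j = i
      · subst hji; simpa using hlt
      · simpa [hji] using h.1 j
    · have hji : j ≠ i := fun e => hj (e ▸ hi)
      simpa [hji] using h.2.1 j hj
    · rw [sum_add_single, h.2.2]
  · intro u hu u' hu' hlt
    obtain ⟨i, hi, m, hm, hmi, rfl⟩ := mem_upShadow.1 hu
    have h := mem_boxLevel.1 (hL.1 hm)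
    have h' := mem_boxLevel.1 hu'
    have hz : ∀ j, j ∉ S → u' j = m j := fun j hj => by rw [h.2.1 j hj, h'.2.1 j hj]
    have hne : (S.filter fun j => 0 < u' j).Nonempty := by
      by_contra hcon
      rw [Finset.not_nonempty_iff_eq_empty, Finset.filter_eq_empty_iff] at hcon
      have hle : ∑ j, u' j ≤ ∑ j, m j := Finset.sum_le_sum fun j _ => by
        by_cases hj : j ∈ S
        · have := hcon hj
          omega
        · exact (hz j hj).le
      omega
    set j := (S.filter fun j => 0 < u' j).max' hne with hj
    have hjmem := Finset.max'_mem _ hne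
    rw [← hj, Finset.mem_filter] at hjmem
    have hjmax : ∀ q ∈ S, j < q → u' q = 0 := by
      intro q hq hjq
      by_contra hcon
      exact absurd (Finset.le_max' (S.filter fun j => 0 < u' j) q
        (Finset.mem_filter.2 ⟨hq, Nat.pos_of_ne_zero hcon⟩)) (not_le.2 hjq)
    set w : ι → ℕ := Function.update u' j (u' j - 1) with hw
    have hwu : w + Pi.single j 1 = u' := by
      funext q
      by_cases hq : q = j
      · subst hq; simp [w]; omega
      · simp [w, hq]
    have hws := sum_add_single w j
    rw [hwu, h'.2.2] at hws
    have hwle : ∀ q, w q ≤ u' q := fun q => by rw [← hwu]; simp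
    have hwP : w ∈ boxLevel b S z d := by
      refine mem_boxLevel.2 ⟨fun q => (hwle q).trans (h'.1 q), fun q hq => ?_, by omega⟩
      have hqj : q ≠ j := fun e => hq (e ▸ hjmem.1)
      simp [w, hqj, h'.2.1 q hq]
    have hwL : w ∈ L := by
      by_contra hcon
      have hmw : m ≠ w := fun e => hcon (e ▸ hm)
      rcases toLex_lt_or hmw with hlt' | hlt'
      · exact hcon (hL.2 m hm w hwP hlt')
      · obtain ⟨p, hp, hplt⟩ := toLex_lt_iff.1 hlt
        obtain ⟨s, hs, hslt⟩ := toLex_lt_iff.1 hlt'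
        have hwq : ∀ q, q ≠ j → w q = u' q := fun q hq => by simp [w, hq]
        have hwj : w j + 1 = u' j := by simp [w]; omega
        apply hmw
        symm
        refine eq_of_le_of_sum_eq (fun q => ?_) (by rw [h.2.2]; omega)
        have hmle : ∀ q, m q ≤ (m + Pi.single i 1 : ι → ℕ) q := fun q => by simp
        have hsj : j ≤ s := by
          by_contra hsj
          push Not at hsj
          have e1 := hwq s hsj.ne
          rcases lt_trichotomy s p with hsp | hsp | hsp
          · have := hp s hsp; have := hmle s; omega
          · subst hsp; have := hmle s; omega
          · have := hs p hsp
            have := hwq p (hsp.trans hsj).ne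
            have := hmle p
            omega
        rcases lt_trichotomy q j with hqj | hqj | hqj
        · exact (hs q (hqj.trans_le hsj)).le
        · subst hqj
          rcases hsj.lt_or_eq with hlt2 | heq
          · exact (hs _ hlt2).le
          · rw [← heq] at hslt; exact hslt.le
        · by_cases hqS : q ∈ S
          · rw [hwq q hqj.ne', hjmax q hqS hqj]; exact Nat.zero_le _
          · rw [hwq q hqj.ne', hz q hqS]
    exact mem_upShadow.2 ⟨j, hjmem.1, w, hwL, by
      have := h'.1 j
      have : w j + 1 = u' j := by simp [w]; omega
      omega, hwu⟩

theorem mem_boxLevel_erase_update {b : ι → ℕ} {S : Finset ι} {z : ι → ℕ} {d : ℕ} {i : ι}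
    (hi : i ∈ S) {t : ℕ} {m : ι → ℕ} :
    m ∈ boxLevel b (S.erase i) (Function.update z i t) d ↔ m ∈ boxLevel b S z d ∧ m i = t := by
  rw [mem_boxLevel, mem_boxLevel]
  constructor
  · rintro ⟨h1, h2, h3⟩
    refine ⟨⟨h1, fun j hj => ?_, h3⟩, by simpa using h2 i (by simp)⟩
    have hji : j ≠ i := fun e => hj (e ▸ hi)
    simpa [hji] using h2 j (fun h => hj (Finset.mem_of_mem_erase h))
  · rintro ⟨⟨h1, h2, h3⟩, h4⟩
    refine ⟨h1, fun j hj => ?_, h3⟩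
    by_cases hji : j = i
    · subst hji; simpa using h4
    · simpa [hji] using h2 j (fun h => hj (Finset.mem_erase.2 ⟨hji, h⟩))

theorem toLex_add_lt_add_iff {m m' e : ι → ℕ} :
    toLex (m + e) < toLex (m' + e) ↔ toLex m < toLex m' := by
  simp [toLex_lt_iff]

theorem add_single_mem_boxLevel {b : ι → ℕ} {S : Finset ι} {z : ι → ℕ} {d : ℕ} {i : ι}
    (hi : i ∈ S) {m : ι → ℕ} :
    m + Pi.single i 1 ∈ boxLevel b S z (d + 1) ↔ m ∈ boxLevel b S z d ∧ m i < b i := by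
  rw [mem_boxLevel, mem_boxLevel, sum_add_single]
  constructor
  · rintro ⟨h1, h2, h3⟩
    refine ⟨⟨fun j => le_trans (by simp) (h1 j), fun j hj => ?_, by omega⟩, by simpa using h1 i⟩
    have hji : j ≠ i := fun e => hj (e ▸ hi)
    simpa [hji] using h2 j hj
  · rintro ⟨⟨h1, h2, h3⟩, h4⟩
    refine ⟨fun j => ?_, fun j hj => ?_, by omega⟩
    · by_cases hji : j = i
      · subst hji; simpa using h4
      · simpa [hji] using h1 j
    · have hji : j ≠ i := fun e => hj (e ▸ hi)
      simpa [hji] using h2 j hj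

theorem IsInitSeg.image_add_single {b : ι → ℕ} {S : Finset ι} {z : ι → ℕ} {d t : ℕ} {i : ι}
    (hi : i ∈ S) (ht : t < b i) {D : Finset (ι → ℕ)}
    (hD : IsInitSeg (boxLevel b (S.erase i) (Function.update z i t) d) D) :
    IsInitSeg (boxLevel b (S.erase i) (Function.update z i (t + 1)) (d + 1))
      (D.image fun m => m + Pi.single i 1) := by
  refine ⟨?_, ?_⟩
  · intro u hu
    obtain ⟨m, hm, rfl⟩ := Finset.mem_image.1 hu
    have h := (mem_boxLevel_erase_update hi).1 (hD.1 hm)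
    exact (mem_boxLevel_erase_update hi).2
      ⟨(add_single_mem_boxLevel hi).2 ⟨h.1, h.2 ▸ ht⟩, by simp [h.2]⟩
  · intro u hu u' hu' hlt
    obtain ⟨m, hm, rfl⟩ := Finset.mem_image.1 hu
    have h' := (mem_boxLevel_erase_update hi).1 hu'
    obtain ⟨m', rfl⟩ := exists_add_single (u := u') (i := i) (by omega)
    rw [add_single_mem_boxLevel hi] at h'
    refine Finset.mem_image.2 ⟨m', hD.2 m hm m' ?_ (toLex_add_lt_add_iff.1 hlt), rfl⟩
    exact (mem_boxLevel_erase_update hi).2 ⟨h'.1.1, by simpa using h'.2⟩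

theorem filter_upShadow {b : ι → ℕ} {S : Finset ι} {i : ι} (hi : i ∈ S) {t : ℕ}
    (ht : t ≤ b i) (B : Finset (ι → ℕ)) :
    ((upShadow b S B).filter fun u => u i = t) =
      upShadow b (S.erase i) (B.filter fun m => m i = t) ∪
        ((B.filter fun m => m i + 1 = t).image fun m => m + Pi.single i 1) := by
  ext u
  simp only [Finset.mem_filter, Finset.mem_union, Finset.mem_image, mem_upShadow]
  constructor
  · rintro ⟨⟨j, hj, m, hm, hlt, rfl⟩, hu⟩
    by_cases hji : j = i
    · subst hji
      exact Or.inr ⟨m, ⟨hm, by simpa using hu⟩, rfl⟩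
    · refine Or.inl ⟨j, Finset.mem_erase.2 ⟨hji, hj⟩, m, ⟨hm, ?_⟩, hlt, rfl⟩
      simpa [Ne.symm hji] using hu
  · rintro (⟨j, hj, m, ⟨hm, hmi⟩, hlt, rfl⟩ | ⟨m, ⟨hm, hmi⟩, rfl⟩)
    · rw [Finset.mem_erase] at hj
      exact ⟨⟨j, hj.2, m, hm, hlt, rfl⟩, by simp [Ne.symm hj.1, hmi]⟩
    · exact ⟨⟨i, hi, m, hm, by omega, rfl⟩, by simp [hmi]⟩


/-- Initial segments have minimal upper shadow among subsets of the levels of the faces of the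
box that are parallel to the directions of `S`. -/
def MinimalShadow (b : ι → ℕ) (S : Finset ι) : Prop :=
  ∀ (z : ι → ℕ) (d : ℕ) (B L : Finset (ι → ℕ)), B ⊆ boxLevel b S z d →
    IsInitSeg (boxLevel b S z d) L → L.card ≤ B.card →
      (upShadow b S L).card ≤ (upShadow b S B).card

theorem upShadow_mono {b : ι → ℕ} {S : Finset ι} {B C : Finset (ι → ℕ)} (h : B ⊆ C) :
    upShadow b S B ⊆ upShadow b S C := by
  intro u hu
  obtain ⟨i, hi, m, hm, hlt, rfl⟩ := mem_upShadow.1 hu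
  exact mem_upShadow.2 ⟨i, hi, m, h hm, hlt, rfl⟩

theorem upShadow_subset {b : ι → ℕ} {S : Finset ι} {z : ι → ℕ} {d : ℕ}
    {B : Finset (ι → ℕ)} (h : B ⊆ boxLevel b S z d) :
    upShadow b S B ⊆ boxLevel b S z (d + 1) := by
  intro u hu
  obtain ⟨i, hi, m, hm, hlt, rfl⟩ := mem_upShadow.1 hu
  exact (add_single_mem_boxLevel hi).2 ⟨h hm, hlt⟩

/-- The slices of `B` in direction `i` are initial segments. -/
def IsCompressed (b : ι → ℕ) (S : Finset ι) (z : ι → ℕ) (d : ℕ) (i : ι)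
    (B : Finset (ι → ℕ)) : Prop :=
  ∀ t, IsInitSeg (boxLevel b (S.erase i) (Function.update z i t) d) (B.filter fun m => m i = t)

theorem card_upShadow_le_of_isCompressed {b : ι → ℕ} {S : Finset ι} {z : ι → ℕ} {d : ℕ} {i : ι}
    (hi : i ∈ S) (hmin : MinimalShadow b (S.erase i)) {B C : Finset (ι → ℕ)}
    (hB : B ⊆ boxLevel b S z d) (hCB : C ⊆ boxLevel b S z d) (hC : IsCompressed b S z d i C)
    (hcard : ∀ t, (C.filter fun m => m i = t).card = (B.filter fun m => m i = t).card) :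
    (upShadow b S C).card ≤ (upShadow b S B).card := by
  have hmaps : ∀ D : Finset (ι → ℕ), D ⊆ boxLevel b S z d →
      ∀ u ∈ upShadow b S D, u i ∈ Finset.range (b i + 1) := fun D hD u hu =>
    Finset.mem_range.2 (Nat.lt_succ_of_le ((mem_boxLevel.1 (upShadow_subset hD hu)).1 i))
  rw [Finset.card_eq_sum_card_fiberwise (hmaps C hCB),
    Finset.card_eq_sum_card_fiberwise (hmaps B hB)]
  refine Finset.sum_le_sum fun t ht => ?_
  have ht' : t ≤ b i := Nat.lt_succ_iff.1 (Finset.mem_range.1 ht)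
  rw [filter_upShadow hi ht', filter_upShadow hi ht']
  have hslice : (B.filter fun m => m i = t) ⊆
      boxLevel b (S.erase i) (Function.update z i t) d := fun m hm => by
    rw [Finset.mem_filter] at hm
    exact (mem_boxLevel_erase_update hi).2 ⟨hB hm.1, hm.2⟩
  have h1 := hmin (Function.update z i t) d _ _ hslice (hC t) (hcard t).le
  rcases t with _ | s
  · simpa using h1
  · simp only [Nat.add_right_cancel_iff]
    have hs1 := isInitSeg_upShadow (hC (s + 1))
    have hs2 := (hC s).image_add_single hi ht'
    have h2 : ((C.filter fun m => m i = s).image fun m => m + Pi.single i 1).card =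
        ((B.filter fun m => m i = s).image fun m => m + Pi.single i 1).card := by
      rw [Finset.card_image_of_injective _ (add_single_injective i),
        Finset.card_image_of_injective _ (add_single_injective i), hcard]
    rcases le_total (upShadow b (S.erase i) (C.filter fun m => m i = s + 1)).card
      ((C.filter fun m => m i = s).image fun m => m + Pi.single i 1).card with h | h
    · rw [Finset.union_eq_right.2 (hs1.subset_of_card_le hs2 h), h2]
      exact Finset.card_le_card Finset.subset_union_right
    · rw [Finset.union_eq_left.2 (hs2.subset_of_card_le hs1 h)]
      exact h1.trans (Finset.card_le_card Finset.subset_union_left)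

theorem exists_isCompressed {b : ι → ℕ} {S : Finset ι} {z : ι → ℕ} {d : ℕ} {i : ι}
    (hi : i ∈ S) {B : Finset (ι → ℕ)} (hB : B ⊆ boxLevel b S z d) :
    ∃ C ⊆ boxLevel b S z d, IsCompressed b S z d i C ∧
      ∀ t, (C.filter fun m => m i = t).card = (B.filter fun m => m i = t).card := by
  have hslice : ∀ t, (B.filter fun m => m i = t) ⊆
      boxLevel b (S.erase i) (Function.update z i t) d := fun t m hm => by
    rw [Finset.mem_filter] at hm
    exact (mem_boxLevel_erase_update hi).2 ⟨hB hm.1, hm.2⟩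
  choose C hC hcard using fun t =>
    exists_isInitSeg _ _ (Finset.card_le_card (hslice t))
  have hfil : ∀ t, (((Finset.range (b i + 1)).biUnion C).filter fun m => m i = t) = C t := by
    intro t
    ext m
    simp only [Finset.mem_filter, Finset.mem_biUnion, Finset.mem_range]
    constructor
    · rintro ⟨⟨s, _, hm⟩, hmt⟩
      have := ((mem_boxLevel_erase_update hi).1 ((hC s).1 hm)).2
      rw [← hmt, this]
      exact hm
    · intro hm
      have h := (mem_boxLevel_erase_update hi).1 ((hC t).1 hm)
      exact ⟨⟨t, Nat.lt_succ_of_le (h.2 ▸ (mem_boxLevel.1 h.1).1 i), hm⟩, h.2⟩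
  refine ⟨(Finset.range (b i + 1)).biUnion C, ?_, fun t => ?_, fun t => ?_⟩
  · intro m hm
    obtain ⟨t, _, hm⟩ := Finset.mem_biUnion.1 hm
    exact ((mem_boxLevel_erase_update hi).1 ((hC t).1 hm)).1
  · rw [hfil]; exact hC t
  · rw [hfil, hcard]

theorem exists_forall_isCompressed {b : ι → ℕ} {S : Finset ι} {z : ι → ℕ} {d : ℕ}
    (hmin : ∀ i ∈ S, MinimalShadow b (S.erase i)) {B : Finset (ι → ℕ)}
    (hB : B ⊆ boxLevel b S z d) :
    ∃ C ⊆ boxLevel b S z d, C.card = B.card ∧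
      (upShadow b S C).card ≤ (upShadow b S B).card ∧ ∀ i ∈ S, IsCompressed b S z d i C := by
  set P := boxLevel b S z d with hP
  obtain ⟨w, hw⟩ := exists_strictAnti_weight P
  induction hN : ∑ m ∈ B, w m using Nat.strong_induction_on generalizing B with
  | _ N ih =>
    by_cases hall : ∀ i ∈ S, IsCompressed b S z d i B
    · exact ⟨B, hB, rfl, le_rfl, hall⟩
    push Not at hall
    obtain ⟨i, hi, hnot⟩ := hall
    obtain ⟨C, hCP, hC, hcard⟩ := exists_isCompressed hi hB
    have hmaps : ∀ D : Finset (ι → ℕ), D ⊆ P → ∀ u ∈ D, u i ∈ Finset.range (b i + 1) :=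
      fun D hD u hu => Finset.mem_range.2 (Nat.lt_succ_of_le ((mem_boxLevel.1 (hD hu)).1 i))
    have hcards : C.card = B.card := by
      rw [Finset.card_eq_sum_card_fiberwise (hmaps C hCP),
        Finset.card_eq_sum_card_fiberwise (hmaps B hB)]
      exact Finset.sum_congr rfl fun t _ => hcard t
    have hsliceP : ∀ t, ∀ m ∈ boxLevel b (S.erase i) (Function.update z i t) d, m ∈ P :=
      fun t m hm => ((mem_boxLevel_erase_update hi).1 hm).1
    have hsliceB : ∀ t, (B.filter fun m => m i = t) ⊆
        boxLevel b (S.erase i) (Function.update z i t) d := fun t m hm => by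
      rw [Finset.mem_filter] at hm
      exact (mem_boxLevel_erase_update hi).2 ⟨hB hm.1, hm.2⟩
    have hstrict : ∀ t, (C.filter fun m => m i = t) ≠ (B.filter fun m => m i = t) →
        ∑ m ∈ C with m i = t, w m < ∑ m ∈ B with m i = t, w m := fun t hne =>
      (hC t).sum_lt w (fun m hm m' hm' => hw m (hsliceP t m hm) m' (hsliceP t m' hm'))
        (hsliceB t) (hcard t) hne
    have hlt : ∑ m ∈ C, w m < ∑ m ∈ B, w m := by
      rw [← Finset.sum_fiberwise_of_maps_to (hmaps C hCP),
        ← Finset.sum_fiberwise_of_maps_to (hmaps B hB)]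
      have hex : ∃ t, (C.filter fun m => m i = t) ≠ (B.filter fun m => m i = t) := by
        by_contra hcon
        push Not at hcon
        exact hnot fun t => hcon t ▸ hC t
      obtain ⟨t, ht⟩ := hex
      refine Finset.sum_lt_sum (fun s _ => ?_) ⟨t, ?_, hstrict t ht⟩
      · by_cases hs : (C.filter fun m => m i = s) = (B.filter fun m => m i = s)
        · rw [hs]
        · exact (hstrict s hs).le
      · by_contra hcon
        rw [Finset.mem_range, not_lt] at hcon
        apply ht
        rw [Finset.filter_false_of_mem, Finset.filter_false_of_mem]
        · intro m hm
          have := (mem_boxLevel.1 (hB hm)).1 i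
          omega
        · intro m hm
          have := (mem_boxLevel.1 (hCP hm)).1 i
          omega
    obtain ⟨D, hDP, hDC, hDs, hD⟩ := ih _ (hN ▸ hlt) hCP rfl
    exact ⟨D, hDP, hDC.trans hcards, hDs.trans
      (card_upShadow_le_of_isCompressed hi (hmin i hi) hB hCP hC hcard), hD⟩

theorem mem_of_isCompressed {b : ι → ℕ} {S : Finset ι} {z : ι → ℕ} {d : ℕ} {i : ι}
    (hi : i ∈ S) {B : Finset (ι → ℕ)} (hB : IsCompressed b S z d i B) {u v : ι → ℕ}
    (hv : v ∈ B) (hu : u ∈ boxLevel b S z d) (hlt : toLex v < toLex u) (h : u i = v i) :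
    u ∈ B :=
  (Finset.mem_filter.1 ((hB (v i)).2 v (Finset.mem_filter.2 ⟨hv, rfl⟩) u
    ((mem_boxLevel_erase_update hi).2 ⟨hu, h⟩) hlt)).1

theorem add_single_mem_of_isCompressed {b : ι → ℕ} {S : Finset ι} {z : ι → ℕ} {d : ℕ}
    (hS : 3 ≤ S.card) {B : Finset (ι → ℕ)} (hB : ∀ i ∈ S, IsCompressed b S z d i B)
    {m : ι → ℕ} {i j : ι} (h : i < j) (hj : m + Pi.single j 1 ∈ B)
    (hi : m + Pi.single i 1 ∈ boxLevel b S z d) : m + Pi.single i 1 ∈ B := by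
  have hpos : 0 < ((S.erase i).erase j).card := by
    have h1 := Finset.pred_card_le_card_erase (s := S) (a := i)
    have h2 := Finset.pred_card_le_card_erase (s := S.erase i) (a := j)
    omega
  obtain ⟨k, hk⟩ := Finset.card_pos.1 hpos
  rw [Finset.mem_erase, Finset.mem_erase] at hk
  exact mem_of_isCompressed hk.2.2 (hB k hk.2.2) hj hi (toLex_add_single_lt h)
    (by simp [hk.1, hk.2.1])

theorem toLex_lt_of_isCompressed {b : ι → ℕ} {S : Finset ι} {z : ι → ℕ} {d : ℕ}
    (hS : 3 ≤ S.card) {B : Finset (ι → ℕ)} (hBP : B ⊆ boxLevel b S z d)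
    (hB : ∀ i ∈ S, IsCompressed b S z d i B) {q : ι} (hq : q ∈ S) (hmax : ∀ i ∈ S, i ≤ q)
    {u v : ι → ℕ} (hu : u ∈ boxLevel b S z d) (huB : u ∉ B) (hv : v ∈ B) (huv : u q ≤ v q) :
    toLex u < toLex v := by
  induction hN : v q using Nat.strong_induction_on generalizing v with
  | _ N ih =>
    have hne : u ≠ v := fun e => huB (e ▸ hv)
    refine (toLex_lt_or hne).resolve_right fun hlt => ?_
    have hvq : u q < v q := lt_of_le_of_ne huv fun e =>
      huB (mem_of_isCompressed hq (hB q hq) hv hu hlt e)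
    have hu' := mem_boxLevel.1 hu
    have hv' := mem_boxLevel.1 (hBP hv)
    obtain ⟨p, hp, hplt⟩ := toLex_lt_iff.1 hlt
    have hpS : p ∈ S := by
      by_contra hcon
      rw [hu'.2.1 p hcon, hv'.2.1 p hcon] at hplt
      exact lt_irrefl _ hplt
    have hpq : p < q := lt_of_le_of_ne (hmax p hpS) fun e => by subst e; omega
    have hpJ : p ∈ S.filter fun j => j < q ∧ v j < b j :=
      Finset.mem_filter.2 ⟨hpS, hpq, hplt.trans_le (hu'.1 p)⟩
    obtain ⟨j, hj, hjmax⟩ := Finset.exists_max_image _ id ⟨p, hpJ⟩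
    have hpj : p ≤ j := hjmax p hpJ
    rw [Finset.mem_filter] at hj
    obtain ⟨hjS, hjq, hjb⟩ := hj
    obtain ⟨m, rfl⟩ := exists_add_single (u := v) (i := q) (by omega)
    have hd : ∃ e, d = e + 1 := ⟨∑ i, m i, by rw [← hv'.2.2, sum_add_single]⟩
    obtain ⟨e, rfl⟩ := hd
    have hm := (add_single_mem_boxLevel hq).1 (hBP hv)
    have hwP : m + Pi.single j 1 ∈ boxLevel b S z (e + 1) :=
      (add_single_mem_boxLevel hjS).2 ⟨hm.1, by simpa [hjq.ne] using hjb⟩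
    have hwB := add_single_mem_of_isCompressed hS hB hjq hv hwP
    have hwq : (m + Pi.single j 1 : ι → ℕ) q = m q := by simp [hjq.ne']
    have hvq' : (m + Pi.single q 1 : ι → ℕ) q = m q + 1 := by simp
    have hvx : ∀ x, x ≠ q → (m + Pi.single q 1 : ι → ℕ) x = m x := fun x hx => by simp [hx]
    have hwx : ∀ x, x ≠ j → (m + Pi.single j 1 : ι → ℕ) x = m x := fun x hx => by simp [hx]
    have hwj : (m + Pi.single j 1 : ι → ℕ) j = m j + 1 := by simp
    have hlt' := ih (m q) (by omega) hwB (by omega) hwq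
    obtain ⟨s, hs, hslt⟩ := toLex_lt_iff.1 hlt'
    rcases lt_trichotomy s p with hsp | rfl | hsp
    · have h1 := hwx s (hsp.trans_le hpj).ne
      have h2 := hp s hsp
      have h3 := hvx s (hsp.trans hpq).ne
      omega
    · have h3 := hvx s hpq.ne
      by_cases hsj : s = j
      · subst hsj; omega
      · have := hwx s hsj; omega
    · have hpj' : p = j := by
        by_contra hcon
        have h1 := hs p hsp
        have h2 := hwx p hcon
        have h3 := hvx p hpq.ne
        omega
      subst hpj'
      have hw' := mem_boxLevel.1 hwP
      have heq : u = m + Pi.single p 1 := by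
        refine eq_of_le_of_sum_eq (fun x => ?_) (by rw [hu'.2.2, hw'.2.2])
        rcases lt_or_ge x s with hx | hx
        · exact (hs x hx).le
        · by_cases hxS : x ∈ S
          · rcases (hmax x hxS).lt_or_eq with hxq | rfl
            · by_contra hcon
              have hpx : p < x := hsp.trans_le hx
              have h1 := hwx x hpx.ne'
              have h2 := hvx x hxq.ne
              have h3 := hu'.1 x
              exact absurd (hjmax x (Finset.mem_filter.2 ⟨hxS, hxq, by omega⟩)) (not_le.2 hpx)
            · omega
          · rw [hu'.2.1 x hxS, hw'.2.1 x hxS]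
      exact huB (heq ▸ hwB)

theorem IsInitSeg.card_filter_upShadow_le {b : ι → ℕ} {S : Finset ι} {z : ι → ℕ} {d : ℕ}
    {L : Finset (ι → ℕ)} (hL : IsInitSeg (boxLevel b S z d) L) {q : ι} (hq : q ∈ S)
    (hmax : ∀ i ∈ S, i ≤ q) :
    ((upShadow b S L).filter fun u => 0 < u q).card ≤ (L.filter fun m => m q < b q).card := by
  rw [← Finset.card_image_of_injective (L.filter fun m => m q < b q) (add_single_injective q)]
  refine Finset.card_le_card fun u hu => ?_
  rw [Finset.mem_filter] at hu
  obtain ⟨hu, huq⟩ := hu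
  have huP := upShadow_subset hL.1 hu
  obtain ⟨i, hi, m, hm, hlt, rfl⟩ := mem_upShadow.1 hu
  obtain ⟨m', hm'⟩ := exists_add_single huq
  rw [← hm', add_single_mem_boxLevel hq] at huP
  refine Finset.mem_image.2 ⟨m', Finset.mem_filter.2 ⟨?_, huP.2⟩, hm'⟩
  rcases (hmax i hi).lt_or_eq with hiq | rfl
  · refine hL.2 m hm m' huP.1 ?_
    rw [← toLex_add_lt_add_iff (e := Pi.single q 1), hm']
    exact toLex_add_single_lt hiq
  · rwa [add_single_injective i hm']

theorem card_filter_le_card_filter_upShadow {b : ι → ℕ} {S : Finset ι} {q : ι} (hq : q ∈ S)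
    (B : Finset (ι → ℕ)) :
    (B.filter fun m => m q < b q).card ≤ ((upShadow b S B).filter fun u => 0 < u q).card := by
  rw [← Finset.card_image_of_injective _ (add_single_injective q)]
  refine Finset.card_le_card fun u hu => ?_
  obtain ⟨m, hm, rfl⟩ := Finset.mem_image.1 hu
  rw [Finset.mem_filter] at hm
  exact Finset.mem_filter.2 ⟨mem_upShadow.2 ⟨q, hq, m, hm.1, hm.2, rfl⟩, by simp⟩

theorem card_upShadow_le_of_forall_isCompressed {b : ι → ℕ} {S : Finset ι} {z : ι → ℕ} {d : ℕ}
    (hS : 3 ≤ S.card) {B L : Finset (ι → ℕ)} (hBP : B ⊆ boxLevel b S z d)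
    (hB : ∀ i ∈ S, IsCompressed b S z d i B) (hL : IsInitSeg (boxLevel b S z d) L)
    (hcard : L.card ≤ B.card) : (upShadow b S L).card ≤ (upShadow b S B).card := by
  obtain ⟨q, hq, hmax⟩ := Finset.exists_max_image S id (Finset.card_pos.1 (by omega))
  have hkey : ∀ u ∈ L, u ∉ B → ∀ v ∈ B, u q ≤ v q → v ∈ L := fun u hu huB v hv huv =>
    hL.2 u hu v (hBP hv) (toLex_lt_of_isCompressed hS hBP hB hq hmax (hL.1 hu) huB hv huv)
  have hzero : ∀ u ∈ L, u q = 0 → u ∈ B := by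
    intro u hu hu0
    by_contra huB
    have hBL : B ⊆ L := fun v hv => hkey u hu huB v hv (by omega)
    exact huB (Finset.eq_of_subset_of_card_le hBL hcard ▸ hu)
  have htop : (L.filter fun m => m q < b q).card ≤ (B.filter fun m => m q < b q).card := by
    by_contra hcon
    have hnot : ¬ (L.filter fun m => m q < b q) ⊆ (B.filter fun m => m q < b q) :=
      fun h => hcon (Finset.card_le_card h)
    obtain ⟨u, hu, huB⟩ := Finset.not_subset.1 hnot
    rw [Finset.mem_filter] at hu huB
    have hsub : (B.filter fun m => ¬ m q < b q) ⊆ (L.filter fun m => ¬ m q < b q) := by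
      intro v hv
      rw [Finset.mem_filter] at hv ⊢
      exact ⟨hkey u hu.1 (fun h => huB ⟨h, hu.2⟩) v hv.1 (by omega), hv.2⟩
    have h1 := Finset.card_le_card hsub
    have h2 := Finset.card_filter_add_card_filter_not (s := B) fun m => m q < b q
    have h3 := Finset.card_filter_add_card_filter_not (s := L) fun m => m q < b q
    omega
  have hbot : ((upShadow b S L).filter fun u => ¬ 0 < u q) ⊆
      ((upShadow b S B).filter fun u => ¬ 0 < u q) := by
    intro u hu
    rw [Finset.mem_filter] at hu ⊢
    refine ⟨?_, hu.2⟩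
    obtain ⟨i, hi, m, hm, hlt, rfl⟩ := mem_upShadow.1 hu.1
    have hm0 : m q = 0 := by
      have := hu.2
      simp only [Pi.add_apply] at this
      omega
    exact mem_upShadow.2 ⟨i, hi, m, hzero m hm hm0, hlt, rfl⟩
  rw [← Finset.card_filter_add_card_filter_not (s := upShadow b S L) fun u => 0 < u q,
    ← Finset.card_filter_add_card_filter_not (s := upShadow b S B) fun u => 0 < u q]
  exact add_le_add (((hL.card_filter_upShadow_le hq hmax).trans htop).trans
    (card_filter_le_card_filter_upShadow hq B)) (Finset.card_le_card hbot)

theorem eq_of_mem_boxLevel {b : ι → ℕ} {S : Finset ι} {z : ι → ℕ} {d : ℕ} (i : ι)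
    {m m' : ι → ℕ} (hm : m ∈ boxLevel b S z d) (hm' : m' ∈ boxLevel b S z d)
    (h : ∀ j ∈ S, j ≠ i → m j = m' j) : m = m' := by
  rw [mem_boxLevel] at hm hm'
  have hall : ∀ j, j ≠ i → m j = m' j := fun j hj => by
    by_cases hjS : j ∈ S
    · exact h j hjS hj
    · rw [hm.2.1 j hjS, hm'.2.1 j hjS]
  rcases le_total (m i) (m' i) with hle | hle
  · refine eq_of_le_of_sum_eq (fun j => ?_) (hm.2.2.trans hm'.2.2.symm)
    by_cases hj : j = i
    · exact hj ▸ hle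
    · exact (hall j hj).le
  · refine (eq_of_le_of_sum_eq (fun j => ?_) (hm'.2.2.trans hm.2.2.symm)).symm
    by_cases hj : j = i
    · exact hj ▸ hle
    · exact (hall j hj).ge

theorem minimalShadow_of_card_le_one {b : ι → ℕ} {S : Finset ι} (hS : S.card ≤ 1) :
    MinimalShadow b S := by
  intro z d B L hB hL hcard
  refine Finset.card_le_card (upShadow_mono fun u hu => ?_)
  obtain ⟨v, hv⟩ := Finset.card_pos.1 ((Finset.card_pos.2 ⟨u, hu⟩).trans_le hcard)
  suffices u = v from this ▸ hv
  rcases S.eq_empty_or_nonempty with rfl | ⟨i, hi⟩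
  · funext j
    rw [(mem_boxLevel.1 (hL.1 hu)).2.1 j (by simp), (mem_boxLevel.1 (hB hv)).2.1 j (by simp)]
  · exact eq_of_mem_boxLevel i (hL.1 hu) (hB hv) fun j hj hji =>
      absurd (Finset.card_le_one.1 hS j hj i hi) hji

theorem card_le_card_upShadow_pair {b : ι → ℕ} {p q : ι} (hpq : p < q) {z : ι → ℕ} {d : ℕ}
    {B : Finset (ι → ℕ)} (hB : B ⊆ boxLevel b {p, q} z d) {u : ι → ℕ}
    (hu : u ∈ boxLevel b {p, q} z d) (huB : u ∉ B) :
    B.card ≤ (upShadow b {p, q} B).card := by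
  have hsum : ∀ m ∈ boxLevel b {p, q} z d, m p + m q = u p + u q := by
    intro m hm
    rw [mem_boxLevel] at hm hu
    have h1 := Finset.sum_add_sum_compl {p, q} m
    have h2 := Finset.sum_add_sum_compl {p, q} u
    rw [Finset.sum_pair hpq.ne] at h1 h2
    have h3 : ∑ i ∈ ({p, q} : Finset ι)ᶜ, m i = ∑ i ∈ ({p, q} : Finset ι)ᶜ, u i :=
      Finset.sum_congr rfl fun i hi => by
        rw [Finset.mem_compl] at hi
        rw [hm.2.1 i hi, hu.2.1 i hi]
    omega
  have hext : ∀ m ∈ boxLevel b {p, q} z d, ∀ m' ∈ boxLevel b {p, q} z d, m p = m' p → m = m' :=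
    fun m hm m' hm' h => eq_of_mem_boxLevel q hm hm' fun j hj hjq => by
      have : j = p := by simpa [hjq] using hj
      rw [this, h]
  have hup := (mem_boxLevel.1 hu).1
  refine Finset.card_le_card_of_injOn
    (fun m => if m p < u p then m + Pi.single p 1 else m + Pi.single q 1) ?_ ?_
  · intro m hm
    have hmB : m ∈ B := hm
    have h1 := hsum m (hB hmB)
    by_cases hlt : m p < u p
    · simp only [hlt, if_true]
      exact mem_upShadow.2 ⟨p, by simp, m, hmB, hlt.trans_le (hup p), rfl⟩
    · simp only [hlt, if_false]
      have hne : m p ≠ u p := fun e => huB (hext m (hB hmB) u hu e ▸ hmB)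
      exact mem_upShadow.2 ⟨q, by simp, m, hmB, by have := hup q; omega, rfl⟩
  · intro m hm m' hm' heq
    have hmB : m ∈ B := hm
    have hmB' : m' ∈ B := hm'
    have hne : m p ≠ u p := fun e => huB (hext m (hB hmB) u hu e ▸ hmB)
    have hne' : m' p ≠ u p := fun e => huB (hext m' (hB hmB') u hu e ▸ hmB')
    refine hext m (hB hmB) m' (hB hmB') ?_
    have h := congrFun heq p
    by_cases h1 : m p < u p <;> by_cases h2 : m' p < u p <;>
      simp [h1, h2, hpq.ne] at h <;> omega

theorem card_lt_card_upShadow_pair {b : ι → ℕ} {p q : ι} (hpq : p < q) {z : ι → ℕ} {d : ℕ}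
    (hb : b p ≤ b q) {B : Finset (ι → ℕ)} (hB : B ⊆ boxLevel b {p, q} z d)
    (hne : B.Nonempty) {u : ι → ℕ} (hu : u ∈ boxLevel b {p, q} z (d + 1)) (huq : u q = 0) :
    B.card < (upShadow b {p, q} B).card := by
  have hroom : ∀ m ∈ B, m p + m q < b p := by
    intro m hm
    have hm := mem_boxLevel.1 (hB hm)
    rw [mem_boxLevel] at hu
    have h1 := Finset.sum_add_sum_compl {p, q} m
    have h2 := Finset.sum_add_sum_compl {p, q} u
    rw [Finset.sum_pair hpq.ne] at h1 h2
    have h3 : ∑ i ∈ ({p, q} : Finset ι)ᶜ, m i = ∑ i ∈ ({p, q} : Finset ι)ᶜ, u i :=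
      Finset.sum_congr rfl fun i hi => by
        rw [Finset.mem_compl] at hi
        rw [hm.2.1 i hi, hu.2.1 i hi]
    have := hu.1 p
    omega
  obtain ⟨x, hx, hmax⟩ := Finset.exists_max_image B (fun m => m p) hne
  rw [← Finset.card_image_of_injective _ (add_single_injective q)]
  refine Finset.card_lt_card ((Finset.ssubset_iff_of_subset fun v hv => ?_).2
    ⟨x + Pi.single p 1, ?_, fun hv => ?_⟩)
  · obtain ⟨m, hm, rfl⟩ := Finset.mem_image.1 hv
    exact mem_upShadow.2 ⟨q, by simp, m, hm, by have := hroom m hm; omega, rfl⟩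
  · exact mem_upShadow.2 ⟨p, by simp, x, hx, by have := hroom x hx; omega, rfl⟩
  · obtain ⟨m, hm, heq⟩ := Finset.mem_image.1 hv
    have h := congrFun heq p
    have h' := hmax m hm
    simp [hpq.ne] at h
    omega

theorem minimalShadow_pair {b : ι → ℕ} {p q : ι} (hpq : p < q) (hb : b p ≤ b q) :
    MinimalShadow b {p, q} := by
  intro z d B L hB hL hcard
  by_cases hPB : boxLevel b {p, q} z d ⊆ B
  · exact Finset.card_le_card (upShadow_mono (hL.1.trans hPB))
  obtain ⟨u, hu, huB⟩ := Finset.not_subset.1 hPB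
  have h1 := card_le_card_upShadow_pair hpq hB hu huB
  have h2 : ((upShadow b {p, q} L).filter fun u => 0 < u q).card ≤ L.card :=
    (hL.card_filter_upShadow_le (q := q) (by simp) (by simp [hpq.le])).trans
      (Finset.card_filter_le _ _)
  have h3 := Finset.card_filter_add_card_filter_not (s := upShadow b {p, q} L) fun u => 0 < u q
  rcases ((upShadow b {p, q} L).filter fun u => ¬ 0 < u q).eq_empty_or_nonempty with
    hemp | ⟨v, hv⟩
  · rw [hemp, Finset.card_empty] at h3
    omega
  · have hLne : L.Nonempty := by
      obtain ⟨i, hi, m, hm, _⟩ := mem_upShadow.1 (Finset.mem_filter.1 hv).1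
      exact ⟨m, hm⟩
    have hP : ∀ w ∈ (upShadow b {p, q} L).filter fun u => ¬ 0 < u q,
        w ∈ boxLevel b {p, q} z (d + 1) ∧ w q = 0 := fun w hw => by
      rw [Finset.mem_filter] at hw
      exact ⟨upShadow_subset hL.1 hw.1, by omega⟩
    have h4 : ((upShadow b {p, q} L).filter fun u => ¬ 0 < u q).card ≤ 1 :=
      Finset.card_le_one.2 fun w hw w' hw' =>
        eq_of_mem_boxLevel p (hP w hw).1 (hP w' hw').1 fun j hj hjp => by
          have hjq : j = q := by simpa [hjp] using hj
          rw [hjq, (hP w hw).2, (hP w' hw').2]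
    have h5 := card_lt_card_upShadow_pair hpq hb hB
      (Finset.card_pos.1 (hLne.card_pos.trans_le hcard)) (hP v hv).1 (hP v hv).2
    omega

/-- The **Clements–Lindström theorem**. -/
theorem minimalShadow_of_monotoneOn {b : ι → ℕ} (S : Finset ι) (hb : MonotoneOn b S) :
    MinimalShadow b S := by
  induction S using Finset.strongInduction with
  | _ S ih =>
    rcases le_or_gt S.card 1 with h1 | h1
    · exact minimalShadow_of_card_le_one h1
    rcases Nat.lt_or_ge S.card 3 with h3 | h3
    · obtain ⟨p, q, hpq, rfl⟩ := Finset.card_eq_two.1 (show S.card = 2 by omega)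
      rcases lt_or_gt_of_ne hpq with h | h
      · exact minimalShadow_pair h (hb (by simp) (by simp) h.le)
      · rw [Finset.pair_comm]
        exact minimalShadow_pair h (hb (by simp) (by simp) h.le)
    · intro z d B L hB hL hcard
      obtain ⟨C, hCP, hCB, hsh, hC⟩ := exists_forall_isCompressed
        (fun i hi => ih (S.erase i) (Finset.erase_ssubset hi)
          (hb.mono (Finset.coe_subset.2 (Finset.erase_subset i S)))) hB
      exact (card_upShadow_le_of_forall_isCompressed h3 hCP hC hL (hCB ▸ hcard)).trans hsh

end Shadow

section LeadingExponents

variable {K : Type*} [Field K] {n : ℕ}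

theorem sum_eq_of_coeff_ne_zero {d : ℕ} {f : MvPolynomial (Fin n) K}
    (hf : f ∈ homogeneousSubmodule (Fin n) K d) {e : Fin n →₀ ℕ} (he : coeff e f ≠ 0) :
    ∑ i, e i = d := by
  have h := (mem_homogeneousSubmodule d f).1 hf he
  rw [← h, Finsupp.weight_apply, Finsupp.sum_fintype _ _ (by simp)]
  simp

theorem monomial_mem_homogeneousSubmodule {d : ℕ} {e : Fin n →₀ ℕ} (he : ∑ i, e i = d) :
    (monomial e (1 : K) : MvPolynomial (Fin n) K) ∈ homogeneousSubmodule (Fin n) K d := by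
  rw [mem_homogeneousSubmodule]
  refine isHomogeneous_monomial _ ?_
  rw [Finsupp.degree_eq_sum, he]

/-- The exponent vectors of the lexicographic leading monomials of the elements of `V`. -/
def leadingExps (V : Submodule K (MvPolynomial (Fin n) K)) : Set (Fin n → ℕ) :=
  {e | ∃ f ∈ V, f ≠ 0 ∧ ⇑(MonomialOrder.lex.degree f) = e}

theorem sum_eq_of_mem_leadingExps {V : Submodule K (MvPolynomial (Fin n) K)} {d : ℕ}
    (hV : V ≤ homogeneousSubmodule (Fin n) K d) {e : Fin n → ℕ} (he : e ∈ leadingExps V) :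
    ∑ i, e i = d := by
  obtain ⟨f, hf, hf0, rfl⟩ := he
  exact sum_eq_of_coeff_ne_zero (hV hf) (MonomialOrder.lex.coeff_degree_ne_zero_iff.2 hf0)

theorem finite_leadingExps {V : Submodule K (MvPolynomial (Fin n) K)} {d : ℕ}
    (hV : V ≤ homogeneousSubmodule (Fin n) K d) : (leadingExps V).Finite := by
  refine (Set.finite_Iic (fun _ : Fin n => d)).subset fun e he i => ?_
  rw [← sum_eq_of_mem_leadingExps hV he]
  exact Finset.single_le_sum (f := e) (fun _ _ => Nat.zero_le _) (Finset.mem_univ i)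

theorem monomial_mem_leadingExps {V : Submodule K (MvPolynomial (Fin n) K)} {e : Fin n →₀ ℕ}
    (he : (monomial e (1 : K) : MvPolynomial (Fin n) K) ∈ V) : ⇑e ∈ leadingExps V := by
  classical
  exact ⟨_, he, by simp, by rw [MonomialOrder.degree_monomial, if_neg one_ne_zero]⟩

theorem finrank_eq_ncard_leadingExps {V : Submodule K (MvPolynomial (Fin n) K)} {d : ℕ}
    (hV : V ≤ homogeneousSubmodule (Fin n) K d) :
    Module.finrank K V = (leadingExps V).ncard := by
  classical
  have : Finite (leadingExps V) := finite_leadingExps hV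
  have : Fintype (leadingExps V) := Fintype.ofFinite _
  rw [← Nat.card_coe_set_eq, Nat.card_eq_fintype_card]
  let φ : V →ₗ[K] (leadingExps V → K) :=
    LinearMap.pi fun e => (lcoeff K (Finsupp.equivFunOnFinite.symm e.1)).comp V.subtype
  have hφ : Function.Injective φ := by
    rw [← LinearMap.ker_eq_bot, LinearMap.ker_eq_bot']
    intro f hf
    by_contra hf0
    have hf0' : (f : MvPolynomial (Fin n) K) ≠ 0 := fun h => hf0 (Subtype.ext h)
    have h := congrFun hf ⟨_, f, f.2, hf0', rfl⟩
    refine MonomialOrder.lex.coeff_degree_ne_zero_iff.2 hf0' ?_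
    simpa [φ] using h
  have : Module.Finite K V := Module.Finite.of_injective φ hφ
  refine le_antisymm ?_ ?_
  · have := LinearMap.finrank_le_finrank_of_injective hφ
    rwa [Module.finrank_fintype_fun_eq_card] at this
  · choose F hFV hF0 hFe using fun e : leadingExps V => e.2
    have hdeg : ∀ e e' : leadingExps V,
        MonomialOrder.lex.degree (F e) = MonomialOrder.lex.degree (F e') → e = e' :=
      fun e e' h => Subtype.ext (by rw [← hFe e, ← hFe e', h])
    have hli : LinearIndependent K fun e : leadingExps V => (⟨F e, hFV e⟩ : V) := by
      rw [Fintype.linearIndependent_iff]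
      intro c hc
      by_contra hcon
      push Not at hcon
      obtain ⟨e₀, he₀⟩ := hcon
      obtain ⟨e, he, hmax⟩ := Finset.exists_max_image (Finset.univ.filter fun e => c e ≠ 0)
        (fun e => MonomialOrder.lex.toSyn (MonomialOrder.lex.degree (F e)))
        ⟨e₀, by simpa using he₀⟩
      have hce : c e ≠ 0 := by simpa using he
      have h := congrArg (fun f : V =>
        coeff (MonomialOrder.lex.degree (F e)) (f : MvPolynomial (Fin n) K)) hc
      simp only [Submodule.coe_sum, Submodule.coe_smul, coeff_sum, coeff_smul,
        ZeroMemClass.coe_zero, coeff_zero, smul_eq_mul] at h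
      rw [Finset.sum_eq_single e] at h
      · exact mul_ne_zero hce (MonomialOrder.lex.coeff_degree_ne_zero_iff.2 (hF0 e)) h
      · intro e' _ hne
        by_cases hce' : c e' = 0
        · rw [hce', zero_mul]
        · rw [MonomialOrder.coeff_eq_zero_of_lt, mul_zero]
          refine lt_of_le_of_ne (hmax e' (by simpa using hce')) fun h => hne ?_
          exact hdeg e' e (MonomialOrder.lex.toSyn.injective h)
      · simp
    exact hli.fintype_card_le_finrank

end LeadingExponents

section LexPlusPowers

variable {K : Type*} [Field K] {n r : ℕ}

theorem coeff_eq_zero_of_mem_purePowers {hrn : r ≤ n} {a : Fin r → ℕ}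
    {f : MvPolynomial (Fin n) K} (hf : f ∈ purePowers K hrn a) {e : Fin n →₀ ℕ}
    (he : ∀ i, e (Fin.castLE hrn i) < a i) : coeff e f = 0 := by
  by_contra hcon
  have hspan : purePowers K hrn a = Ideal.span ((fun m => monomial m (1 : K)) ''
      Set.range fun i : Fin r => Finsupp.single (Fin.castLE hrn i) (a i)) := by
    rw [purePowers, ← Set.range_comp]
    simp only [Function.comp_def, X_pow_eq_monomial]
  rw [hspan, mem_ideal_span_monomial_image] at hf
  obtain ⟨_, ⟨i, rfl⟩, hi⟩ := hf e (mem_support_iff.2 hcon)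
  have := hi (Fin.castLE hrn i)
  rw [Finsupp.single_eq_same] at this
  exact absurd (he i) (not_lt.2 this)

theorem monomial_mem_purePowers {hrn : r ≤ n} {a : Fin r → ℕ} {e : Fin n →₀ ℕ} {i : Fin r}
    (he : a i ≤ e (Fin.castLE hrn i)) :
    (monomial e (1 : K) : MvPolynomial (Fin n) K) ∈ purePowers K hrn a := by
  have h : e - Finsupp.single (Fin.castLE hrn i) (a i) + Finsupp.single (Fin.castLE hrn i) (a i)
      = e := tsub_add_cancel_of_le (by simpa using he)
  rw [← h, ← mul_one (1 : K), ← monomial_mul, ← X_pow_eq_monomial]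
  exact Ideal.mul_mem_left _ _ (Ideal.subset_span ⟨i, rfl⟩)

theorem component_le (J : Ideal (MvPolynomial (Fin n) K)) (d : ℕ) :
    component J d ≤ homogeneousSubmodule (Fin n) K d :=
  inf_le_right

open scoped Classical in
/-- The exponent vectors in the box bounded by `b` of the leading monomials of `J_d`. -/
noncomputable def boxedExps (b : Fin n → ℕ) (J : Ideal (MvPolynomial (Fin n) K)) (d : ℕ) :
    Finset (Fin n → ℕ) :=
  (boxLevel b Finset.univ 0 d).filter (· ∈ leadingExps (component J d))

theorem mem_boxedExps {b : Fin n → ℕ} {J : Ideal (MvPolynomial (Fin n) K)} {d : ℕ}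
    {e : Fin n → ℕ} : e ∈ boxedExps b J d ↔
      (∀ i, e i ≤ b i) ∧ e ∈ leadingExps (component J d) := by
  classical
  rw [boxedExps, Finset.mem_filter, mem_boxLevel]
  constructor
  · exact fun h => ⟨h.1.1, h.2⟩
  · exact fun h => ⟨⟨h.1, by simp, sum_eq_of_mem_leadingExps (component_le J d) h.2⟩, h.2⟩

theorem boxedExps_subset (b : Fin n → ℕ) (J : Ideal (MvPolynomial (Fin n) K)) (d : ℕ) :
    boxedExps b J d ⊆ boxLevel b Finset.univ 0 d := by
  classical
  exact Finset.filter_subset _ _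

theorem hilb_eq_add_card_boxedExps {hrn : r ≤ n} {a : Fin r → ℕ} {b : Fin n → ℕ} {d : ℕ}
    (hb : ∀ e : Fin n → ℕ, ∑ i, e i = d →
      ((∀ i, e i ≤ b i) ↔ ∀ i, e (Fin.castLE hrn i) < a i))
    {J : Ideal (MvPolynomial (Fin n) K)} (hJ : purePowers K hrn a ≤ J) :
    hilb J d = {e : Fin n → ℕ | ∑ i, e i = d ∧ ¬ ∀ i, e i ≤ b i}.ncard +
      (boxedExps b J d).card := by
  have hfin := finite_leadingExps (component_le J d)
  have hunion : leadingExps (component J d) =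
      {e : Fin n → ℕ | ∑ i, e i = d ∧ ¬ ∀ i, e i ≤ b i} ∪ (boxedExps b J d : Set _) := by
    ext e
    rw [Set.mem_union, Finset.mem_coe, mem_boxedExps, Set.mem_ofPred_eq]
    constructor
    · intro he
      by_cases h : ∀ i, e i ≤ b i
      · exact Or.inr ⟨h, he⟩
      · exact Or.inl ⟨sum_eq_of_mem_leadingExps (component_le J d) he, h⟩
    · rintro (⟨hd, h⟩ | h)
      · rw [hb e hd] at h
        push Not at h
        obtain ⟨i, hi⟩ := h
        exact monomial_mem_leadingExps (e := Finsupp.equivFunOnFinite.symm e)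
          ⟨hJ (monomial_mem_purePowers hi), monomial_mem_homogeneousSubmodule hd⟩
      · exact h.2
  rw [hilb, finrank_eq_ncard_leadingExps (component_le J d), hunion,
    Set.ncard_union_eq
      (Set.disjoint_left.2 fun e he he' => he.2 (mem_boxedExps.1 (Finset.mem_coe.1 he')).1)
      (hfin.subset (hunion ▸ Set.subset_union_left)) (Finset.finite_toSet _),
    Set.ncard_coe_finset]

theorem exists_coeff_ne_zero_of_mem_mul {J : Ideal (MvPolynomial (Fin n) K)}
    {f : MvPolynomial (Fin n) K} (hf : f ∈ Ideal.span (Set.range X) * J) {e : Fin n →₀ ℕ}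
    (he : coeff e f ≠ 0) :
    ∃ i, ∃ e' : Fin n →₀ ℕ, e' + Finsupp.single i 1 = e ∧ ∃ g ∈ J, coeff e' g ≠ 0 := by
  classical
  by_contra hcon
  push Not at hcon
  refine he (Submodule.mul_induction_on hf (fun p hp g hg => ?_) fun p q hp hq => ?_)
  · induction hp using Submodule.span_induction generalizing g with
    | mem p hp =>
      obtain ⟨i, rfl⟩ := hp
      rw [coeff_X_mul']
      split_ifs with h
      · refine hcon i _ (tsub_add_cancel_of_le ?_) g hg
        simpa [Nat.one_le_iff_ne_zero] using h
      · rfl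
    | zero => simp
    | add p q _ _ hp hq => rw [add_mul, coeff_add, hp g hg, hq g hg, add_zero]
    | smul c p _ hp =>
      rw [smul_eq_mul, mul_comm c p, mul_assoc]
      exact hp _ (Ideal.mul_mem_left _ _ hg)
  · rw [coeff_add, hp, hq, add_zero]

theorem IsLPP.monomial_mem_component {hrn : r ≤ n} {a : Fin r → ℕ}
    {L : Ideal (MvPolynomial (Fin n) K)} (hL : IsLPP hrn a L) {d : ℕ}
    {f : MvPolynomial (Fin n) K} (hf : f ∈ component L d) {e e' : Fin n →₀ ℕ}
    (he : coeff e f ≠ 0) (hlt : ∀ i, e (Fin.castLE hrn i) < a i) (hle : lexLe e e')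
    (hd : ∑ i, e' i = d) :
    (monomial e' (1 : K) : MvPolynomial (Fin n) K) ∈ component L d := by
  classical
  obtain ⟨S, hS, hcomp⟩ := hL.2 d
  rw [hcomp] at hf ⊢
  obtain ⟨g, hg, h, hh, rfl⟩ := Submodule.mem_sup.1 hf
  rw [coeff_add, coeff_eq_zero_of_mem_purePowers hh.1 hlt, add_zero] at he
  have heS : e ∈ S := by
    by_contra hcon
    refine he (Submodule.span_induction (fun p hp => ?_) (by simp) (fun p q _ _ hp hq => ?_)
      (fun c p _ hp => ?_) hg)
    · obtain ⟨m, hm, rfl⟩ := hp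
      rw [coeff_monomial, if_neg fun h : m = e => hcon (h ▸ hm)]
    · rw [coeff_add, hp, hq, add_zero]
    · rw [coeff_smul, hp, smul_zero]
  exact Submodule.mem_sup_left (Submodule.subset_span ⟨e', hS.2 e heS e' hd hle, rfl⟩)

theorem IsLPP.isInitSeg_boxedExps {hrn : r ≤ n} {a : Fin r → ℕ} {b : Fin n → ℕ} {d : ℕ}
    (hb : ∀ e : Fin n → ℕ, ∑ i, e i = d →
      ((∀ i, e i ≤ b i) ↔ ∀ i, e (Fin.castLE hrn i) < a i))
    {L : Ideal (MvPolynomial (Fin n) K)} (hL : IsLPP hrn a L) :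
    IsInitSeg (boxLevel b Finset.univ 0 d) (boxedExps b L d) := by
  refine ⟨boxedExps_subset _ _ _, fun m hm m' hm' hlt => ?_⟩
  obtain ⟨hmb, f, hf, hf0, rfl⟩ := mem_boxedExps.1 hm
  rw [mem_boxLevel] at hm'
  refine mem_boxedExps.2 ⟨hm'.1, ?_⟩
  have hcoeff := MonomialOrder.lex.coeff_degree_ne_zero_iff.2 hf0
  refine monomial_mem_leadingExps (e := Finsupp.equivFunOnFinite.symm m')
    (hL.monomial_mem_component hf hcoeff ?_ (Or.inr hlt) hm'.2.2)
  exact (hb _ (sum_eq_of_coeff_ne_zero hf.2 hcoeff)).1 hmb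

theorem IsLPP.boxedExps_subset_upShadow {hrn : r ≤ n} {a : Fin r → ℕ} {b : Fin n → ℕ} {d : ℕ}
    (hb : ∀ e : Fin n → ℕ, ∑ i, e i ≤ d + 1 →
      ((∀ i, e i ≤ b i) ↔ ∀ i, e (Fin.castLE hrn i) < a i))
    {L : Ideal (MvPolynomial (Fin n) K)} (hL : IsLPP hrn a L) :
    boxedExps b (Ideal.span (Set.range X) * L ⊔ purePowers K hrn a) (d + 1) ⊆
      upShadow b Finset.univ (boxedExps b L d) := by
  intro e he
  obtain ⟨heb, f, hf, hf0, rfl⟩ := mem_boxedExps.1 he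
  have hcoeff := MonomialOrder.lex.coeff_degree_ne_zero_iff.2 hf0
  set e := MonomialOrder.lex.degree f
  have hsum := sum_eq_of_coeff_ne_zero hf.2 hcoeff
  have hlt := (hb e hsum.le).1 heb
  obtain ⟨g, hg, h, hh, hgh⟩ := Submodule.mem_sup.1 hf.1
  rw [← hgh, coeff_add, coeff_eq_zero_of_mem_purePowers hh hlt, add_zero] at hcoeff
  obtain ⟨i, e', he', l, hl, hle'⟩ := exists_coeff_ne_zero_of_mem_mul hg hcoeff
  have he'' : (⇑e' + Pi.single i 1 : Fin n → ℕ) = ⇑e := by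
    rw [← he', Finsupp.coe_add, Finsupp.single_eq_pi_single]
  have hsum' : ∑ j, e' j = d := by
    have := sum_add_single e' i
    rw [he'', hsum] at this
    omega
  have hle : ∀ j, e' j ≤ e j := fun j => by rw [← he'']; simp
  have hlc : homogeneousComponent d l ∈ component L d :=
    ⟨hL.1 l hl d, homogeneousComponent_mem d l⟩
  have hne : coeff e' (homogeneousComponent d l) ≠ 0 := by
    rw [coeff_homogeneousComponent, if_pos]
    · exact hle'
    · rw [Finsupp.degree_eq_sum, hsum']
  have hmem := hL.monomial_mem_component hlc hne (fun j => (hle _).trans_lt (hlt j))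
    (Or.inl rfl) hsum'
  refine mem_upShadow.2 ⟨i, Finset.mem_univ i, e', mem_boxedExps.2
    ⟨fun j => (hle j).trans (heb j), monomial_mem_leadingExps hmem⟩, ?_, he''⟩
  have := heb i
  rw [← he''] at this
  simpa using this

theorem upShadow_boxedExps_subset (b : Fin n → ℕ) (d : ℕ)
    (I F : Ideal (MvPolynomial (Fin n) K)) :
    upShadow b Finset.univ (boxedExps b I d) ⊆
      boxedExps b (Ideal.span (Set.range X) * I ⊔ F) (d + 1) := by
  intro u hu
  have huP := mem_boxLevel.1 (upShadow_subset (z := 0) (d := d) (boxedExps_subset _ _ _) hu)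
  obtain ⟨i, -, m, hm, -, rfl⟩ := mem_upShadow.1 hu
  obtain ⟨-, f, hf, hf0, rfl⟩ := mem_boxedExps.1 hm
  refine mem_boxedExps.2 ⟨huP.1, f * X i, ⟨?_, ?_⟩, mul_ne_zero hf0 (X_ne_zero i), ?_⟩
  · refine Ideal.mem_sup_left ?_
    rw [mul_comm f]
    exact Ideal.mul_mem_mul (Ideal.subset_span ⟨i, rfl⟩) hf.1
  · exact (mem_homogeneousSubmodule _ _).2
      (((mem_homogeneousSubmodule _ _).1 hf.2).mul (isHomogeneous_X K i))
  · rw [MonomialOrder.degree_mul hf0 (X_ne_zero i), MonomialOrder.degree_X, Finsupp.coe_add,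
      Finsupp.single_eq_pi_single]

theorem exists_monotone_bound (hrn : r ≤ n) {a : Fin r → ℕ} (hpos : ∀ i, 0 < a i)
    (hmono : Monotone a) (d : ℕ) :
    ∃ b : Fin n → ℕ, Monotone b ∧ ∀ e : Fin n → ℕ, ∑ i, e i ≤ d →
      ((∀ i, e i ≤ b i) ↔ ∀ i, e (Fin.castLE hrn i) < a i) := by
  refine ⟨fun i => if h : (i : ℕ) < r then a ⟨i, h⟩ - 1 else d + ∑ j, a j, ?_, ?_⟩
  · intro i j hij
    have hij' : (i : ℕ) ≤ j := hij
    by_cases hj : (j : ℕ) < r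
    · have hi : (i : ℕ) < r := hij'.trans_lt hj
      simp only [hi, hj, dif_pos]
      exact Nat.sub_le_sub_right (hmono hij') 1
    · by_cases hi : (i : ℕ) < r
      · simp only [hi, hj, dif_pos, dif_neg, not_false_eq_true]
        have := Finset.single_le_sum (f := a) (fun _ _ => Nat.zero_le _)
          (Finset.mem_univ ⟨i, hi⟩)
        omega
      · simp [hi, hj]
  · intro e he
    constructor
    · intro h i
      have h1 := h (Fin.castLE hrn i)
      have h2 := hpos i
      simp only [Fin.val_castLE, i.2, dif_pos, Fin.eta] at h1
      omega
    · intro h i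
      by_cases hi : (i : ℕ) < r
      · simp only [hi, dif_pos]
        have : e i < a ⟨i, hi⟩ := h ⟨i, hi⟩
        omega
      · simp only [hi, dif_neg, not_false_eq_true]
        have := Finset.single_le_sum (f := e) (fun _ _ => Nat.zero_le _) (Finset.mem_univ i)
        omega

theorem hilb_zero_of_le_span_X {J : Ideal (MvPolynomial (Fin n) K)}
    (hJ : J ≤ Ideal.span (Set.range X)) : hilb J 0 = 0 := by
  have hbot : component J 0 = ⊥ := by
    rw [eq_bot_iff]
    intro f hf
    have hX : Ideal.span (Set.range X) ≤
        RingHom.ker (constantCoeff : MvPolynomial (Fin n) K →+* K) :=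
      Ideal.span_le.2 (by rintro _ ⟨i, rfl⟩; simp)
    have h0 : constantCoeff f = 0 := hX (hJ hf.1)
    have hdeg : f.totalDegree = 0 :=
      Nat.le_zero.1 ((mem_homogeneousSubmodule _ _).1 hf.2).totalDegree_le
    rw [totalDegree_eq_zero_iff_eq_C.1 hdeg, ← constantCoeff_eq, h0, C_0]
    exact Submodule.zero_mem _
  rw [hilb, hbot, finrank_bot]

end LexPlusPowers

/-- **Minimal growth.** If `I ⊆ K[x_1,…,x_n]` is a homogeneous ideal containing the
pure-powers ideal `𝔞` of a degree sequence `a`, and `L` is the `a`-lpp ideal with the same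
Hilbert function as `I`, then `H(𝔪L + 𝔞) ≤ H(𝔪I + 𝔞)` pointwise. -/
theorem minimal_growth {K : Type*} [Field K] {n r : ℕ} (hrn : r ≤ n)
    (a : Fin r → ℕ) (hpos : ∀ i, 0 < a i) (hmono : Monotone a)
    (I : Ideal (MvPolynomial (Fin n) K)) (hI : IsHomog I)
    (hPP : purePowers K hrn a ≤ I)
    (L : Ideal (MvPolynomial (Fin n) K)) (hL : IsLPP hrn a L)
    (hHF : ∀ d : ℕ, hilb L d = hilb I d) :
    ∀ d : ℕ,
      hilb (Ideal.span (Set.range X) * L ⊔ purePowers K hrn a) d ≤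
        hilb (Ideal.span (Set.range X) * I ⊔ purePowers K hrn a) d := by
  have hPL : purePowers K hrn a ≤ L := by
    refine Ideal.span_le.2 ?_
    rintro _ ⟨i, rfl⟩
    obtain ⟨S, -, hS⟩ := hL.2 (a i)
    have hmem : (X (Fin.castLE hrn i) ^ a i : MvPolynomial (Fin n) K) ∈
        component (purePowers K hrn a) (a i) :=
      ⟨Ideal.subset_span ⟨i, rfl⟩, isHomogeneous_X_pow _ _⟩
    have hmem' := Submodule.mem_sup_right (S := Submodule.span K
      ((fun m => (monomial m (1 : K) : MvPolynomial (Fin n) K)) '' S)) hmem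
    rw [← hS] at hmem'
    exact hmem'.1
  rintro (_ | d)
  · rw [hilb_zero_of_le_span_X]
    · exact Nat.zero_le _
    · refine sup_le Ideal.mul_le_left (Ideal.span_le.2 ?_)
      rintro _ ⟨i, rfl⟩
      exact Ideal.pow_mem_of_mem _ (Ideal.subset_span (Set.mem_range_self _)) _ (hpos i)
  · obtain ⟨b, hbmono, hb⟩ := exists_monotone_bound hrn hpos hmono (d + 1)
    have hbd : ∀ e : Fin n → ℕ, ∑ i, e i = d →
        ((∀ i, e i ≤ b i) ↔ ∀ i, e (Fin.castLE hrn i) < a i) := fun e he => hb e (by omega)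
    have hcard : (boxedExps b L d).card = (boxedExps b I d).card := by
      have h := hHF d
      rw [hilb_eq_add_card_boxedExps hbd hPL, hilb_eq_add_card_boxedExps hbd hPP] at h
      omega
    rw [hilb_eq_add_card_boxedExps (fun e he => hb e he.le) le_sup_right,
      hilb_eq_add_card_boxedExps (fun e he => hb e he.le) le_sup_right]
    refine Nat.add_le_add_left ?_ _
    calc _ ≤ (upShadow b Finset.univ (boxedExps b L d)).card :=
          Finset.card_le_card (hL.boxedExps_subset_upShadow hb)
      _ ≤ (upShadow b Finset.univ (boxedExps b I d)).card :=
          minimalShadow_of_monotoneOn Finset.univ (hbmono.monotoneOn _) 0 d _ _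
            (boxedExps_subset _ _ _) (hL.isInitSeg_boxedExps hbd) hcard.le
      _ ≤ _ := Finset.card_le_card (upShadow_boxedExps_subset b d I _)
end

section
/- (Artinian reduction) Let f ⊆ A = K[x_1,…,x_n] be an ideal generated by a homogeneous regular sequence of degree a = (a_1,…,a_r), and let ℓ be a linear form that is a regular element on A/f. Let Ā = A/(ℓ) ≅ K[x_1,…,x_{n−1}] and f̄ = fĀ. If every homogeneous ideal of Ā containing f̄ satisfies EGH_a (in n−1 variables), then every homogeneous ideal of A containing f satisfies EGH_a. -/
open MvPolynomial

section GradedAlgebra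

variable {K : Type*} [Field K] {n : ℕ}

lemma mem_component {I : Ideal (MvPolynomial (Fin n) K)} {d : ℕ} {p : MvPolynomial (Fin n) K} :
    p ∈ component I d ↔ p ∈ I ∧ p.IsHomogeneous d := by
  simp [component]

lemma component_mono {I J : Ideal (MvPolynomial (Fin n) K)} (h : I ≤ J) (d : ℕ) :
    component I d ≤ component J d := fun _ hp =>
  mem_component.2 ⟨h (mem_component.1 hp).1, (mem_component.1 hp).2⟩

instance finite_homogeneousSubmodule (d : ℕ) :
    Module.Finite K (homogeneousSubmodule (Fin n) K d) :=
  Module.Finite.iff_fg.2 (homogeneousSubmodule_fg _ K d)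

instance finite_component (I : Ideal (MvPolynomial (Fin n) K)) (d : ℕ) :
    Module.Finite K (component I d) :=
  Submodule.finiteDimensional_of_le (inf_le_right : _ ≤ homogeneousSubmodule (Fin n) K d)

lemma hilb_mono {I J : Ideal (MvPolynomial (Fin n) K)} (h : I ≤ J) (d : ℕ) :
    hilb I d ≤ hilb J d :=
  Submodule.finrank_mono (component_mono h d)

lemma homogeneousComponent_succ_mul {l : MvPolynomial (Fin n) K} (hl : l.IsHomogeneous 1)
    (p : MvPolynomial (Fin n) K) (d : ℕ) :
    homogeneousComponent (d + 1) (l * p) = l * homogeneousComponent d p := by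
  let := gradedAlgebra (σ := Fin n) (R := K)
  have := DirectSum.coe_decompose_mul_of_left_mem_of_le (homogeneousSubmodule (Fin n) K)
    (n := d + 1) (b := p) ((mem_homogeneousSubmodule 1 l).2 hl) (Nat.le_add_left 1 d)
  exact (decomposition.decompose'_apply _ _).symm.trans
    (this.trans (congrArg (l * ·) (decomposition.decompose'_apply p d)))

lemma homogeneousComponent_zero_mul {l : MvPolynomial (Fin n) K} (hl : l.IsHomogeneous 1)
    (p : MvPolynomial (Fin n) K) :
    homogeneousComponent 0 (l * p) = 0 := by
  let := gradedAlgebra (σ := Fin n) (R := K)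
  have := DirectSum.coe_decompose_mul_of_left_mem_of_not_le (homogeneousSubmodule (Fin n) K)
    (n := 0) (b := p) ((mem_homogeneousSubmodule 1 l).2 hl) one_ne_zero.bot_lt.not_ge
  exact (decomposition.decompose'_apply _ _).symm.trans this

lemma isHomogeneous_of_mul {l : MvPolynomial (Fin n) K} (hl : l.IsHomogeneous 1) (hl0 : l ≠ 0)
    {p : MvPolynomial (Fin n) K} {d : ℕ} (h : (l * p).IsHomogeneous (d + 1)) :
    p.IsHomogeneous d := by
  have h1 := homogeneousComponent_succ_mul hl p d
  rw [homogeneousComponent_eq_self h] at h1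
  rw [mul_left_cancel₀ hl0 h1]
  exact homogeneousComponent_isHomogeneous d p

lemma eq_zero_of_isHomogeneous_zero_mul {l : MvPolynomial (Fin n) K} (hl : l.IsHomogeneous 1)
    {p : MvPolynomial (Fin n) K} (h : (l * p).IsHomogeneous 0) : l * p = 0 := by
  rw [← homogeneousComponent_eq_self h, homogeneousComponent_zero_mul hl]

/-- The colon ideal `I : l`. -/
noncomputable def colonBy (l : MvPolynomial (Fin n) K) (I : Ideal (MvPolynomial (Fin n) K)) :
    Ideal (MvPolynomial (Fin n) K) :=
  Submodule.comap (LinearMap.mulLeft (MvPolynomial (Fin n) K) l) I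

/-- The ideal `l I`. -/
noncomputable def mulBy (l : MvPolynomial (Fin n) K) (I : Ideal (MvPolynomial (Fin n) K)) :
    Ideal (MvPolynomial (Fin n) K) :=
  Submodule.map (LinearMap.mulLeft (MvPolynomial (Fin n) K) l) I

lemma mem_colonBy {l p : MvPolynomial (Fin n) K} {I : Ideal (MvPolynomial (Fin n) K)} :
    p ∈ colonBy l I ↔ l * p ∈ I := Iff.rfl

lemma mem_mulBy {l p : MvPolynomial (Fin n) K} {I : Ideal (MvPolynomial (Fin n) K)} :
    p ∈ mulBy l I ↔ ∃ q ∈ I, l * q = p := Iff.rfl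

lemma le_colonBy (l : MvPolynomial (Fin n) K) (I : Ideal (MvPolynomial (Fin n) K)) :
    I ≤ colonBy l I := fun _ hp => I.mul_mem_left l hp

lemma IsHomog.colonBy {l : MvPolynomial (Fin n) K} (hl : l.IsHomogeneous 1)
    {I : Ideal (MvPolynomial (Fin n) K)} (hI : IsHomog I) : IsHomog (colonBy l I) := by
  intro p hp d
  rw [mem_colonBy, ← homogeneousComponent_succ_mul hl]
  exact hI _ hp _

lemma IsHomog.mulBy {l : MvPolynomial (Fin n) K} (hl : l.IsHomogeneous 1)
    {I : Ideal (MvPolynomial (Fin n) K)} (hI : IsHomog I) : IsHomog (mulBy l I) := by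
  rintro _ ⟨p, hp, rfl⟩ d
  change homogeneousComponent d (l * p) ∈ _
  cases d with
  | zero => rw [homogeneousComponent_zero_mul hl]; exact zero_mem _
  | succ d => exact ⟨_, hI p hp d, (homogeneousComponent_succ_mul hl p d).symm⟩

lemma IsHomog.inf {I J : Ideal (MvPolynomial (Fin n) K)} (hI : IsHomog I) (hJ : IsHomog J) :
    IsHomog (I ⊓ J) := fun p hp d => ⟨hI p hp.1 d, hJ p hp.2 d⟩

lemma IsHomog.sup {I J : Ideal (MvPolynomial (Fin n) K)} (hI : IsHomog I) (hJ : IsHomog J) :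
    IsHomog (I ⊔ J) := by
  intro p hp d
  obtain ⟨x, hx, y, hy, rfl⟩ := Submodule.mem_sup.1 hp
  rw [map_add]
  exact Submodule.add_mem_sup (hI x hx d) (hJ y hy d)

lemma component_sup {I J : Ideal (MvPolynomial (Fin n) K)} (hI : IsHomog I) (hJ : IsHomog J)
    (d : ℕ) : component (I ⊔ J) d = component I d ⊔ component J d := by
  refine le_antisymm (fun p hp => ?_)
    (sup_le (component_mono le_sup_left d) (component_mono le_sup_right d))
  obtain ⟨hp, hd⟩ := mem_component.1 hp
  obtain ⟨x, hx, y, hy, rfl⟩ := Submodule.mem_sup.1 hp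
  rw [← homogeneousComponent_eq_self hd, map_add]
  exact Submodule.add_mem_sup
    (mem_component.2 ⟨hI x hx d, homogeneousComponent_isHomogeneous d x⟩)
    (mem_component.2 ⟨hJ y hy d, homogeneousComponent_isHomogeneous d y⟩)

lemma component_inf (I J : Ideal (MvPolynomial (Fin n) K)) (d : ℕ) :
    component (I ⊓ J) d = component I d ⊓ component J d := by
  ext p
  simp only [mem_component, Submodule.mem_inf]
  tauto

lemma component_mulBy_succ {l : MvPolynomial (Fin n) K} (hl : l.IsHomogeneous 1) (hl0 : l ≠ 0)
    (I : Ideal (MvPolynomial (Fin n) K)) (d : ℕ) :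
    component (mulBy l I) (d + 1) = (component I d).map (LinearMap.mulLeft K l) := by
  ext p
  simp only [mem_component, Submodule.mem_map, LinearMap.mulLeft_apply, mem_mulBy]
  constructor
  · rintro ⟨⟨q, hq, rfl⟩, hd⟩
    exact ⟨q, ⟨hq, isHomogeneous_of_mul hl hl0 hd⟩, rfl⟩
  · rintro ⟨q, ⟨hq, hd⟩, rfl⟩
    exact ⟨⟨q, hq, rfl⟩, add_comm 1 d ▸ hl.mul hd⟩

lemma hilb_mulBy_succ {l : MvPolynomial (Fin n) K} (hl : l.IsHomogeneous 1) (hl0 : l ≠ 0)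
    (I : Ideal (MvPolynomial (Fin n) K)) (d : ℕ) :
    hilb (mulBy l I) (d + 1) = hilb I d := by
  rw [hilb, component_mulBy_succ hl hl0]
  exact (Submodule.equivMapOfInjective (LinearMap.mulLeft K l)
    (fun _ _ h => mul_left_cancel₀ hl0 h) (component I d)).finrank_eq.symm

lemma component_mulBy_zero {l : MvPolynomial (Fin n) K} (hl : l.IsHomogeneous 1)
    (I : Ideal (MvPolynomial (Fin n) K)) : component (mulBy l I) 0 = ⊥ := by
  rw [eq_bot_iff]
  intro p hp
  obtain ⟨⟨q, hq, rfl⟩, hd⟩ := mem_component.1 hp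
  exact eq_zero_of_isHomogeneous_zero_mul hl hd

lemma hilb_sup_add_hilb_inf {I J : Ideal (MvPolynomial (Fin n) K)} (hI : IsHomog I)
    (hJ : IsHomog J) (d : ℕ) :
    hilb (I ⊔ J) d + hilb (I ⊓ J) d = hilb I d + hilb J d := by
  rw [hilb, hilb, component_sup hI hJ, component_inf]
  exact Submodule.finrank_sup_add_finrank_inf_eq _ _

lemma inf_mulBy (l : MvPolynomial (Fin n) K) (I J : Ideal (MvPolynomial (Fin n) K)) :
    I ⊓ mulBy l J = mulBy l (J ⊓ colonBy l I) := by
  ext p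
  constructor
  · rintro ⟨hp, q, hq, rfl⟩
    exact ⟨q, ⟨hq, hp⟩, rfl⟩
  · rintro ⟨q, ⟨hq, hp⟩, rfl⟩
    exact ⟨hp, q, hq, rfl⟩

/-- If `p` has degree `e` and the variables multiply `p` into `I`, then so does any polynomial
without constant term. -/
lemma sub_homogeneousComponent_zero_mul_mem {I : Ideal (MvPolynomial (Fin n) K)}
    {p : MvPolynomial (Fin n) K} (hp : ∀ i, X i * p ∈ I) (h : MvPolynomial (Fin n) K) :
    (h - C (coeff 0 h)) * p ∈ I := by
  induction h using MvPolynomial.induction_on with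
  | C a => simp
  | add f g hf hg =>
    have : (f + g - C (coeff 0 (f + g))) * p
        = (f - C (coeff 0 f)) * p + (g - C (coeff 0 g)) * p := by
      rw [coeff_add, C_add]; ring
    rw [this]
    exact I.add_mem hf hg
  | mul_X f i _ =>
    have : coeff 0 (f * X i) = 0 := by
      classical simp [coeff_mul_X']
    rw [this, C_0, sub_zero, mul_assoc]
    exact I.mul_mem_left _ (hp i)

/-- Gluing the degree-`e` part of a larger ideal `J` onto an ideal `I` that contains all
products of `J_e` with variables. -/
lemma exists_ideal_of_X_mul_mem {I J : Ideal (MvPolynomial (Fin n) K)} (hIJ : I ≤ J)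
    (hI : IsHomog I) (e : ℕ) (h : ∀ i, ∀ p ∈ component J e, X i * p ∈ I) :
    ∃ N : Ideal (MvPolynomial (Fin n) K), IsHomog N ∧ I ≤ N ∧
      component N e = component J e ∧ component N (e + 1) = component I (e + 1) := by
  let N : Ideal (MvPolynomial (Fin n) K) :=
    { carrier := {g | ∃ w ∈ component J e, g - w ∈ I}
      zero_mem' := ⟨0, zero_mem _, by simp⟩
      add_mem' := by
        rintro f g ⟨v, hv, hf⟩ ⟨w, hw, hg⟩
        exact ⟨v + w, add_mem hv hw, by convert I.add_mem hf hg using 1; ring⟩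
      smul_mem' := by
        rintro c g ⟨w, hw, hg⟩
        refine ⟨coeff 0 c • w, Submodule.smul_mem _ _ hw, ?_⟩
        have h1 := sub_homogeneousComponent_zero_mul_mem (fun i => h i w hw) c
        have h2 := I.add_mem (I.mul_mem_left c hg) h1
        rw [smul_eq_mul, smul_eq_C_mul]
        convert h2 using 1
        ring }
  have hN : ∀ g, g ∈ N ↔ ∃ w ∈ component J e, g - w ∈ I := fun g => Iff.rfl
  have hIN : I ≤ N := fun g hg => (hN g).2 ⟨0, zero_mem _, by simpa using hg⟩
  refine ⟨N, ?_, hIN, ?_, ?_⟩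
  · intro g hg d
    obtain ⟨w, hw, hgw⟩ := (hN g).1 hg
    have h1 := hI _ hgw d
    rw [map_sub] at h1
    rw [hN]
    refine ⟨homogeneousComponent d w, ?_, h1⟩
    rw [homogeneousComponent_of_mem (mem_component.1 hw).2]
    split_ifs
    · exact hw
    · exact zero_mem _
  · apply le_antisymm
    · intro g hg
      obtain ⟨hg, hd⟩ := mem_component.1 hg
      obtain ⟨w, hw, hgw⟩ := (hN g).1 hg
      refine mem_component.2 ⟨?_, hd⟩
      simpa using J.add_mem (hIJ hgw) (mem_component.1 hw).1
    · intro g hg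
      exact mem_component.2 ⟨(hN g).2 ⟨g, hg, by simp⟩, (mem_component.1 hg).2⟩
  · refine le_antisymm (fun g hg => ?_) (component_mono hIN _)
    obtain ⟨hg, hd⟩ := mem_component.1 hg
    obtain ⟨w, hw, hgw⟩ := (hN g).1 hg
    refine mem_component.2 ⟨?_, hd⟩
    have h1 := hI _ hgw (e + 1)
    rwa [map_sub, homogeneousComponent_eq_self hd,
      homogeneousComponent_of_mem (mem_component.1 hw).2, if_neg (by omega), sub_zero] at h1

end GradedAlgebra

section IdealChains

variable {K : Type*} [Field K] {n : ℕ}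

/-- An increasing chain of homogeneous ideals containing `F`. -/
structure IsIdealChain (F : Ideal (MvPolynomial (Fin n) K))
    (J : ℕ → Ideal (MvPolynomial (Fin n) K)) : Prop where
  le_succ : ∀ k, J k ≤ J (k + 1)
  isHomog : ∀ k, IsHomog (J k)
  le : ∀ k, F ≤ J k

/-- The `N`-th partial sum of the degree-`D` Hilbert function of `⨁ₖ J k zᵏ`. -/
noncomputable def chainHilb (J : ℕ → Ideal (MvPolynomial (Fin n) K)) (D N : ℕ) : ℕ :=
  ∑ k ∈ Finset.range N, hilb (J k) (D - k)

/-- The largest subchain of `J` starting with `J 0` such that multiplication by `l` lowers the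
index. -/
noncomputable def colonChain (l : MvPolynomial (Fin n) K)
    (J : ℕ → Ideal (MvPolynomial (Fin n) K)) : ℕ → Ideal (MvPolynomial (Fin n) K)
  | 0 => J 0
  | k + 1 => J (k + 1) ⊓ colonBy l (colonChain l J k)

/-- One stabilization step: the ideal `⨁ₖ J k zᵏ` is replaced by the initial ideal of its image
under `zᵏ⁺¹ ↦ zᵏ (z + l)`. -/
noncomputable def stabilize (l : MvPolynomial (Fin n) K)
    (J : ℕ → Ideal (MvPolynomial (Fin n) K)) (k : ℕ) : Ideal (MvPolynomial (Fin n) K) :=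
  colonChain l J k ⊔ mulBy l (J (k + 1))

variable {l : MvPolynomial (Fin n) K} {J : ℕ → Ideal (MvPolynomial (Fin n) K)}
  {F : Ideal (MvPolynomial (Fin n) K)}

lemma colonChain_le (k : ℕ) : colonChain l J k ≤ J k := by
  cases k with
  | zero => exact le_rfl
  | succ k => exact inf_le_left

lemma colonChain_isIdealChain (hl : l.IsHomogeneous 1) (hJ : IsIdealChain F J) :
    IsIdealChain F (colonChain l J) where
  le_succ k := le_inf ((colonChain_le k).trans (hJ.le_succ k)) (le_colonBy l _)
  isHomog k := by
    induction k with
    | zero => exact hJ.isHomog 0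
    | succ k ih => exact (hJ.isHomog _).inf (ih.colonBy hl)
  le k := by
    induction k with
    | zero => exact hJ.le 0
    | succ k ih => exact le_inf (hJ.le _) (ih.trans (le_colonBy l _))

lemma stabilize_isIdealChain (hl : l.IsHomogeneous 1) (hJ : IsIdealChain F J) :
    IsIdealChain F (stabilize l J) where
  le_succ k := sup_le_sup ((colonChain_isIdealChain hl hJ).le_succ k)
    (Submodule.map_mono (hJ.le_succ _))
  isHomog k := ((colonChain_isIdealChain hl hJ).isHomog k).sup ((hJ.isHomog _).mulBy hl)
  le k := ((colonChain_isIdealChain hl hJ).le k).trans le_sup_left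

lemma hilb_stabilize_succ (hl : l.IsHomogeneous 1) (hl0 : l ≠ 0) (hJ : IsIdealChain F J)
    (k e : ℕ) :
    hilb (stabilize l J k) (e + 1) + hilb (colonChain l J (k + 1)) e =
      hilb (colonChain l J k) (e + 1) + hilb (J (k + 1)) e := by
  have h := hilb_sup_add_hilb_inf ((colonChain_isIdealChain hl hJ).isHomog k)
    ((hJ.isHomog (k + 1)).mulBy hl) (e + 1)
  rwa [inf_mulBy, hilb_mulBy_succ hl hl0, hilb_mulBy_succ hl hl0] at h

lemma hilb_stabilize_zero (hl : l.IsHomogeneous 1) (hJ : IsIdealChain F J) (k : ℕ) :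
    hilb (stabilize l J k) 0 = hilb (colonChain l J k) 0 := by
  rw [hilb, stabilize, component_sup ((colonChain_isIdealChain hl hJ).isHomog k)
    ((hJ.isHomog (k + 1)).mulBy hl), component_mulBy_zero hl, sup_bot_eq]
  rfl

lemma chainHilb_stabilize_add (hl : l.IsHomogeneous 1) (hl0 : l ≠ 0) (hJ : IsIdealChain F J)
    {D N : ℕ} (hN : N ≤ D) :
    chainHilb (stabilize l J) D N + hilb (colonChain l J N) (D - N) =
      chainHilb J D N + hilb (J N) (D - N) := by
  induction N with
  | zero => rfl
  | succ N ih =>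
    have h1 := ih (by omega)
    obtain ⟨e, rfl⟩ : ∃ e, D = N + (e + 1) := ⟨D - N - 1, by omega⟩
    have h2 := hilb_stabilize_succ hl hl0 hJ N e
    unfold chainHilb at *
    rw [Finset.sum_range_succ, Finset.sum_range_succ]
    have e1 : N + (e + 1) - N = e + 1 := by omega
    have e2 : N + (e + 1) - (N + 1) = e := by omega
    rw [e1] at h1 ⊢
    rw [e2]
    omega

lemma chainHilb_stabilize (hl : l.IsHomogeneous 1) (hl0 : l ≠ 0) (hJ : IsIdealChain F J)
    (D : ℕ) : chainHilb (stabilize l J) D (D + 1) = chainHilb J D (D + 1) := by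
  have h := chainHilb_stabilize_add hl hl0 hJ (le_refl D)
  rw [Nat.sub_self, ← hilb_stabilize_zero hl hJ] at h
  simpa only [chainHilb, Finset.sum_range_succ, Nat.sub_self] using h

lemma chainHilb_le {J : ℕ → Ideal (MvPolynomial (Fin n) K)} {D M N : ℕ} (h : M ≤ N) :
    chainHilb J D M ≤ chainHilb J D N :=
  Finset.sum_le_sum_of_subset (Finset.range_subset_range.2 h)

/-- Every chain can be replaced by one with the same total Hilbert function in which the
variables multiply each degree-`d` layer into the preceding one. -/
lemma exists_stable_chain (hJ : IsIdealChain F J) (d : ℕ) :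
    ∃ J' : ℕ → Ideal (MvPolynomial (Fin n) K), IsIdealChain F J' ∧
      (∀ D, chainHilb J' D (D + 1) = chainHilb J D (D + 1)) ∧
      ∀ k < d, ∀ i, ∀ p ∈ component (J' (k + 1)) (d - (k + 1)), X i * p ∈ J' k := by
  let good : Set (ℕ → Ideal (MvPolynomial (Fin n) K)) :=
    {J' | IsIdealChain F J' ∧ ∀ D, chainHilb J' D (D + 1) = chainHilb J D (D + 1)}
  let W : (ℕ → Ideal (MvPolynomial (Fin n) K)) → ℕ := fun J' =>
    ∑ N ∈ Finset.range (d + 1), chainHilb J' d N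
  have hfin : (W '' good).Finite := by
    refine (Set.finite_Iic ((d + 1) * chainHilb J d (d + 1))).subset ?_
    rintro _ ⟨J', hJ', rfl⟩
    refine (Finset.sum_le_card_nsmul _ _ (chainHilb J d (d + 1)) fun N hN => ?_).trans ?_
    · rw [← hJ'.2 d]
      exact chainHilb_le (Finset.mem_range.1 hN).le
    · simp
  obtain ⟨_, ⟨J', hJ', rfl⟩, hmax⟩ :=
    Set.exists_max_image (W '' good) id hfin ⟨_, J, ⟨hJ, fun _ => rfl⟩, rfl⟩
  refine ⟨J', hJ'.1, hJ'.2, fun k hk i p hp => ?_⟩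
  have hl := isHomogeneous_X K i
  have hl0 : (X i : MvPolynomial (Fin n) K) ≠ 0 := X_ne_zero i
  have hle := hmax _ ⟨stabilize (X i) J', ⟨stabilize_isIdealChain hl hJ'.1, fun D =>
    (chainHilb_stabilize hl hl0 hJ'.1 D).trans (hJ'.2 D)⟩, rfl⟩
  have hN : ∀ N ∈ Finset.range (d + 1),
      chainHilb J' d N ≤ chainHilb (stabilize (X i) J') d N := fun N hN => by
    have h1 := chainHilb_stabilize_add hl hl0 hJ'.1 (Nat.lt_succ_iff.1 (Finset.mem_range.1 hN))
    have h2 := hilb_mono (colonChain_le (l := X i) (J := J') N) (d - N)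
    omega
  have heq := (Finset.sum_eq_sum_iff_of_le hN).1 (le_antisymm (Finset.sum_le_sum hN) hle)
    (k + 1) (Finset.mem_range.2 (by omega))
  have h1 := chainHilb_stabilize_add hl hl0 hJ'.1 (show k + 1 ≤ d from hk)
  have h2 : component (colonChain (X i) J' (k + 1)) (d - (k + 1)) =
      component (J' (k + 1)) (d - (k + 1)) :=
    Submodule.eq_of_le_of_finrank_le (component_mono (colonChain_le _) _)
      (by unfold hilb at h1; omega)
  rw [← h2] at hp
  exact colonChain_le k (mem_component.1 hp).1.2

end IdealChains

section Quotient

variable {K : Type*} [Field K] {m n : ℕ}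
  {φ : MvPolynomial (Fin n) K →ₐ[K] MvPolynomial (Fin m) K}

lemma isHomogeneous_algHom (hφ : ∀ i, (φ (X i)).IsHomogeneous 1)
    {p : MvPolynomial (Fin n) K} {d : ℕ} (hp : p.IsHomogeneous d) : (φ p).IsHomogeneous d := by
  have h := hp.aeval (fun i => φ (X i)) hφ
  rw [one_mul] at h
  exact aeval_unique φ ▸ h

lemma homogeneousComponent_algHom (hφ : ∀ i, (φ (X i)).IsHomogeneous 1)
    (p : MvPolynomial (Fin n) K) (d : ℕ) :
    homogeneousComponent d (φ p) = φ (homogeneousComponent d p) := by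
  induction p using MvPolynomial.induction_on' with
  | add p q hp hq => simp only [map_add, hp, hq]
  | monomial u a =>
    have h := isHomogeneous_monomial a (rfl : u.degree = u.degree)
    rw [homogeneousComponent_of_mem h, homogeneousComponent_of_mem (isHomogeneous_algHom hφ h)]
    split_ifs <;> simp

lemma IsHomog.map (hφ : ∀ i, (φ (X i)).IsHomogeneous 1) (hsurj : Function.Surjective φ)
    {I : Ideal (MvPolynomial (Fin n) K)} (hI : IsHomog I) : IsHomog (I.map φ) := by
  intro p hp d
  obtain ⟨q, hq, rfl⟩ := (Ideal.mem_map_iff_of_surjective φ hsurj).1 hp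
  rw [homogeneousComponent_algHom hφ]
  exact Ideal.mem_map_of_mem φ (hI q hq d)

lemma component_map (hφ : ∀ i, (φ (X i)).IsHomogeneous 1) (hsurj : Function.Surjective φ)
    {I : Ideal (MvPolynomial (Fin n) K)} (hI : IsHomog I) (d : ℕ) :
    component (I.map φ) d = (component I d).map φ.toLinearMap := by
  ext p
  constructor
  · intro hp
    obtain ⟨hp, hd⟩ := mem_component.1 hp
    obtain ⟨q, hq, rfl⟩ := (Ideal.mem_map_iff_of_surjective φ hsurj).1 hp
    refine ⟨_, mem_component.2 ⟨hI q hq d, homogeneousComponent_isHomogeneous d q⟩, ?_⟩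
    rw [AlgHom.toLinearMap_apply, ← homogeneousComponent_algHom hφ,
      homogeneousComponent_eq_self hd]
  · rintro ⟨q, hq, rfl⟩
    obtain ⟨hq, hd⟩ := mem_component.1 hq
    exact mem_component.2 ⟨Ideal.mem_map_of_mem φ hq, isHomogeneous_algHom hφ hd⟩

lemma hilb_eq_hilb_map_add (hφ : ∀ i, (φ (X i)).IsHomogeneous 1)
    (hsurj : Function.Surjective φ) {l : MvPolynomial (Fin n) K}
    (hker : RingHom.ker φ = Ideal.span {l})
    {I : Ideal (MvPolynomial (Fin n) K)} (hI : IsHomog I) (d : ℕ) :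
    hilb I d = hilb (I.map φ) d + hilb (mulBy l (colonBy l I)) d := by
  have h := LinearMap.finrank_range_add_finrank_ker (φ.toLinearMap.domRestrict (component I d))
  rw [LinearMap.range_domRestrict, ← component_map hφ hsurj hI, LinearMap.ker_domRestrict] at h
  change _ + Module.finrank K ((LinearMap.ker φ.toLinearMap).submoduleOf (component I d)) = _ at h
  have hk : (LinearMap.ker φ.toLinearMap).submoduleOf (component I d) =
      (component (mulBy l (colonBy l I)) d).submoduleOf (component I d) := by
    ext ⟨p, hp⟩
    obtain ⟨hp, hd⟩ := mem_component.1 hp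
    have hp' : φ p = 0 ↔ ∃ q, q * l = p := by
      rw [← RingHom.mem_ker, hker, Ideal.mem_span_singleton']
    simp only [Submodule.submoduleOf, Submodule.mem_comap, Submodule.subtype_apply,
      LinearMap.mem_ker, AlgHom.toLinearMap_apply, mem_component, mem_mulBy, mem_colonBy, hp',
      hd, and_true]
    constructor
    · rintro ⟨q, rfl⟩
      exact ⟨q, by rwa [mul_comm], mul_comm _ _⟩
    · rintro ⟨q, -, rfl⟩
      exact ⟨q, mul_comm _ _⟩
  have hle : component (mulBy l (colonBy l I)) d ≤ component I d :=
    component_mono (by rintro _ ⟨q, hq, rfl⟩; exact hq) d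
  rw [hk, (Submodule.submoduleOfEquivOfLe hle).finrank_eq] at h
  exact h.symm

/-- The chain of images of the ideals `I : lᵏ` under `φ`. -/
noncomputable def imageChain (φ : MvPolynomial (Fin n) K →ₐ[K] MvPolynomial (Fin m) K)
    (l : MvPolynomial (Fin n) K) (I : Ideal (MvPolynomial (Fin n) K)) (k : ℕ) :
    Ideal (MvPolynomial (Fin m) K) :=
  ((colonBy l)^[k] I).map φ

lemma imageChain_isIdealChain (hφ : ∀ i, (φ (X i)).IsHomogeneous 1)
    (hsurj : Function.Surjective φ) {l : MvPolynomial (Fin n) K} (hl : l.IsHomogeneous 1)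
    {F I : Ideal (MvPolynomial (Fin n) K)} (hI : IsHomog I) (hF : F ≤ I) :
    IsIdealChain (F.map φ) (imageChain φ l I) where
  le_succ k := by
    unfold imageChain
    rw [Function.iterate_succ_apply']
    exact Ideal.map_mono (le_colonBy l _)
  isHomog k := by
    have h : IsHomog ((colonBy l)^[k] I) := by
      induction k with
      | zero => exact hI
      | succ k ih => rw [Function.iterate_succ_apply']; exact ih.colonBy hl
    exact h.map hφ hsurj
  le k := by
    refine Ideal.map_mono ?_
    induction k with
    | zero => exact hF
    | succ k ih => rw [Function.iterate_succ_apply']; exact ih.trans (le_colonBy l _)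

lemma hilb_eq_chainHilb (hφ : ∀ i, (φ (X i)).IsHomogeneous 1)
    (hsurj : Function.Surjective φ) {l : MvPolynomial (Fin n) K} (hl : l.IsHomogeneous 1)
    (hl0 : l ≠ 0) (hker : RingHom.ker φ = Ideal.span {l})
    {I : Ideal (MvPolynomial (Fin n) K)} (hI : IsHomog I) (d : ℕ) :
    hilb I d = chainHilb (imageChain φ l I) d (d + 1) := by
  induction d generalizing I with
  | zero =>
    rw [hilb_eq_hilb_map_add hφ hsurj hker hI]
    have h : hilb (mulBy l (colonBy l I)) 0 = 0 := by
      rw [hilb, component_mulBy_zero hl, finrank_bot]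
    simp [chainHilb, imageChain, h]
  | succ d ih =>
    rw [hilb_eq_hilb_map_add hφ hsurj hker hI, hilb_mulBy_succ hl hl0, ih (hI.colonBy hl),
      chainHilb, chainHilb, Finset.sum_range_succ' _ (d + 1), add_comm]
    simp [imageChain]

end Quotient

section LexPlusPowersSets

variable {n r : ℕ}

lemma expDeg_add (u v : Fin n →₀ ℕ) : expDeg (u + v) = expDeg u + expDeg v := by
  simp [expDeg, Finset.sum_add_distrib]

lemma expDeg_single (i : Fin n) (k : ℕ) : expDeg (Finsupp.single i k) = k := by
  simp [expDeg, Finsupp.single_apply]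

lemma expDeg_eq_degree (u : Fin n →₀ ℕ) : expDeg u = u.degree :=
  (Finsupp.degree_eq_sum u).symm

lemma lexLe_iff_toLex {u v : Fin n →₀ ℕ} : lexLe u v ↔ toLex u ≤ toLex v := by
  rw [le_iff_eq_or_lt, Finsupp.Lex.lt_iff]
  rfl

lemma lexLe_trans {u v w : Fin n →₀ ℕ} (h : lexLe u v) (h' : lexLe v w) : lexLe u w :=
  lexLe_iff_toLex.2 ((lexLe_iff_toLex.1 h).trans (lexLe_iff_toLex.1 h'))

lemma lexLe_total (u v : Fin n →₀ ℕ) : lexLe u v ∨ lexLe v u := by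
  simp only [lexLe_iff_toLex]
  exact le_total _ _

/-- The monomial with exponent vector `u` lies in the pure-powers ideal. -/
def HasPower (hrn : r ≤ n) (a : Fin r → ℕ) (u : Fin n →₀ ℕ) : Prop :=
  ∃ i : Fin r, a i ≤ u (Fin.castLE hrn i)

lemma HasPower.mono {hrn : r ≤ n} {a : Fin r → ℕ} {u v : Fin n →₀ ℕ} (h : HasPower hrn a u)
    (huv : u ≤ v) : HasPower hrn a v :=
  h.imp fun _ hi => hi.trans (huv _)

/-- The exponent vectors of degree `d`. -/
def monos (n d : ℕ) : Finset (Fin n →₀ ℕ) := Finset.finsuppAntidiag Finset.univ d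

lemma mem_monos {d : ℕ} {u : Fin n →₀ ℕ} : u ∈ monos n d ↔ expDeg u = d := by
  simp [monos, expDeg]

/-- The exponent vectors of a degree-`d` lex-plus-powers space. -/
structure IsLppSet (hrn : r ≤ n) (a : Fin r → ℕ) (d : ℕ) (U : Finset (Fin n →₀ ℕ)) : Prop where
  deg : ∀ u ∈ U, expDeg u = d
  pow : ∀ u, expDeg u = d → HasPower hrn a u → u ∈ U
  up : ∀ u ∈ U, ¬ HasPower hrn a u → ∀ v, expDeg v = d → lexLe u v → v ∈ U

variable {hrn : r ≤ n} {a : Fin r → ℕ} {d : ℕ}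

lemma IsLppSet.subset_or_subset {U V : Finset (Fin n →₀ ℕ)} (hU : IsLppSet hrn a d U)
    (hV : IsLppSet hrn a d V) : U ⊆ V ∨ V ⊆ U := by
  by_contra! h
  obtain ⟨u, hu, huV⟩ := Finset.not_subset.1 h.1
  obtain ⟨v, hv, hvU⟩ := Finset.not_subset.1 h.2
  rcases lexLe_total u v with huv | hvu
  · exact hvU (hU.up u hu (fun hp => huV (hV.pow u (hU.deg u hu) hp)) v (hV.deg v hv) huv)
  · exact huV (hV.up v hv (fun hp => hvU (hU.pow v (hV.deg v hv) hp)) u (hU.deg u hu) hvu)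

lemma IsLppSet.subset_of_card_le {U V : Finset (Fin n →₀ ℕ)} (hU : IsLppSet hrn a d U)
    (hV : IsLppSet hrn a d V) (h : U.card ≤ V.card) : U ⊆ V :=
  (hU.subset_or_subset hV).elim id fun h' => (Finset.eq_of_subset_of_card_le h' h).symm.subset

open Classical in
lemma exists_isLppSet_card_eq (hrn : r ≤ n) (a : Fin r → ℕ) {S : Finset (Fin n →₀ ℕ)}
    (hS : S ⊆ monos n d) (hpow : (monos n d).filter (HasPower hrn a) ⊆ S) :
    ∃ L, IsLppSet hrn a d L ∧ L.card = S.card := by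
  have key : ∀ h, ((monos n d).filter (HasPower hrn a)).card ≤ h → h ≤ (monos n d).card →
      ∃ L, IsLppSet hrn a d L ∧ L.card = h := by
    intro h hh
    induction h, hh using Nat.le_induction with
    | base =>
      refine fun _ => ⟨_, ⟨fun u hu => ?_, fun u hu hp => ?_, fun u hu hp => ?_⟩, rfl⟩
      · exact mem_monos.1 (Finset.mem_filter.1 hu).1
      · exact Finset.mem_filter.2 ⟨mem_monos.2 hu, hp⟩
      · exact absurd (Finset.mem_filter.1 hu).2 hp
    | succ h _ ih =>
      intro hle
      obtain ⟨L, hL, rfl⟩ := ih (by omega)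
      have hne : (monos n d \ L).Nonempty := by
        rw [← Finset.card_pos]
        have := Finset.le_card_sdiff L (monos n d)
        omega
      obtain ⟨u, hu, hmax⟩ := Finset.exists_max_image _ toLex hne
      obtain ⟨hud, huL⟩ := Finset.mem_sdiff.1 hu
      refine ⟨insert u L, ⟨?_, ?_, ?_⟩, Finset.card_insert_of_notMem huL⟩
      · intro v hv
        rcases Finset.mem_insert.1 hv with rfl | hv
        · exact mem_monos.1 hud
        · exact hL.deg v hv
      · exact fun v hv hp => Finset.mem_insert_of_mem (hL.pow v hv hp)
      · intro v hv hp w hw hvw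
        by_cases hwL : w ∈ L
        · exact Finset.mem_insert_of_mem hwL
        rcases Finset.mem_insert.1 hv with rfl | hv
        · have h1 := hmax w (Finset.mem_sdiff.2 ⟨mem_monos.2 hw, hwL⟩)
          have h2 := le_antisymm h1 (lexLe_iff_toLex.1 hvw)
          rw [toLex_inj] at h2
          exact h2 ▸ Finset.mem_insert_self _ _
        · exact absurd (hL.up v hv hp w hw hvw) hwL
  exact key _ (Finset.card_le_card hpow) (Finset.card_le_card hS)

/-- A monomial outside the pure-powers ideal that is lex-smaller than another one of larger degree
can be multiplied by a variable keeping both properties. -/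
lemma exists_add_single_lexLe {u v : Fin n →₀ ℕ} (hu : ¬ HasPower hrn a u)
    (hv : ¬ HasPower hrn a v) (hdeg : expDeg v < expDeg u) (hvu : lexLe v u) :
    ∃ j, ¬ HasPower hrn a (v + Finsupp.single j 1) ∧ lexLe (v + Finsupp.single j 1) u := by
  have hadm : ∀ j, v j < u j → ¬ HasPower hrn a (v + Finsupp.single j 1) := by
    rintro j hj ⟨i, hi⟩
    by_cases hij : j = Fin.castLE hrn i
    · subst hij
      exact hu ⟨i, by simp at hi; omega⟩
    · exact hv ⟨i, by simpa [Finsupp.single_apply, hij] using hi⟩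
  obtain rfl | ⟨i, hlt, hi⟩ := hvu
  · exact absurd hdeg (lt_irrefl _)
  by_cases hex : ∃ j, i < j ∧ v j < u j
  · obtain ⟨j, hij, hj⟩ := hex
    refine ⟨j, hadm j hj, Or.inr ⟨i, fun k hk => ?_, ?_⟩⟩
    · simpa [Finsupp.single_apply, (hk.trans hij).ne'] using hlt k hk
    · simpa [Finsupp.single_apply, hij.ne'] using hi
  · push Not at hex
    refine ⟨i, hadm i hi, ?_⟩
    rcases (Nat.succ_le_of_lt hi).lt_or_eq with h | h
    · refine Or.inr ⟨i, fun k hk => ?_, by simpa using h⟩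
      simpa [Finsupp.single_apply, hk.ne'] using hlt k hk
    · left
      have hle : ∀ k ∈ Finset.univ, u k ≤ (v + Finsupp.single i 1 : Fin n →₀ ℕ) k := by
        intro k _
        rcases lt_trichotomy k i with hk | rfl | hk
        · simp [hlt k hk]
        · simp [← h]
        · simpa [Finsupp.single_apply, hk.ne] using hex k hk
      have hsum : ∑ k, u k = ∑ k, (v + Finsupp.single i 1 : Fin n →₀ ℕ) k := by
        refine le_antisymm (Finset.sum_le_sum hle) ?_
        change expDeg (v + Finsupp.single i 1) ≤ expDeg u
        rw [expDeg_add, expDeg_single]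
        omega
      ext k
      exact ((Finset.sum_eq_sum_iff_of_le hle).1 hsum k (Finset.mem_univ k)).symm

open Classical in
/-- The exponents of the degree-`d + 1` part of the ideal generated by a set of monomials of degree
`d` and the pure powers. -/
noncomputable def shadow (hrn : r ≤ n) (a : Fin r → ℕ) (d : ℕ) (L : Finset (Fin n →₀ ℕ)) :
    Finset (Fin n →₀ ℕ) :=
  (monos n (d + 1)).filter fun u => HasPower hrn a u ∨ ∃ v ∈ L, ∃ i, v + Finsupp.single i 1 = u

lemma mem_shadow {L : Finset (Fin n →₀ ℕ)} {u : Fin n →₀ ℕ} :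
    u ∈ shadow hrn a d L ↔ expDeg u = d + 1 ∧
      (HasPower hrn a u ∨ ∃ v ∈ L, ∃ i, v + Finsupp.single i 1 = u) := by
  simp [shadow, mem_monos]

lemma exists_eq_add_single {u : Fin n →₀ ℕ} {j : Fin n} (h : u j ≠ 0) :
    ∃ v, v + Finsupp.single j 1 = u :=
  ⟨u - Finsupp.single j 1, tsub_add_cancel_of_le (by simpa [Nat.one_le_iff_ne_zero] using h)⟩

/-- Dividing the lex-larger monomial by its last variable and the smaller one by any variable
preserves the lex order. -/
lemma lexLe_of_add_single {v w : Fin n →₀ ℕ} {i j : Fin n} (hdeg : expDeg v = expDeg w)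
    (hj : ∀ k, j < k → w k = 0)
    (h : lexLe (v + Finsupp.single i 1) (w + Finsupp.single j 1)) : lexLe v w := by
  rcases lexLe_total v w with hvw | hwv
  · exact hvw
  obtain rfl | ⟨q, hq, hlt⟩ := hwv
  · exact Or.inl rfl
  exfalso
  by_cases hqj : j ≤ q
  · refine hdeg.not_gt (Finset.sum_lt_sum (fun k _ => ?_) ⟨q, Finset.mem_univ q, hlt⟩)
    rcases lt_trichotomy k q with hk | rfl | hk
    · exact (hq k hk).le
    · exact hlt.le
    · rw [hj k (hqj.trans_lt hk)]
      exact Nat.zero_le _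
  · push Not at hqj
    have hlt' : toLex (w + Finsupp.single j 1) < toLex (v + Finsupp.single i 1) := by
      rw [Finsupp.Lex.lt_iff]
      by_cases hqi : i < q
      · refine ⟨i, fun k hk => ?_, ?_⟩
        · simp [hk.ne', (hk.trans (hqi.trans hqj)).ne', hq k (hk.trans hqi)]
        · simp [(hqi.trans hqj).ne', hq i hqi]
      · push Not at hqi
        refine ⟨q, fun k hk => ?_, ?_⟩
        · simp [(hk.trans_le hqi).ne', (hk.trans hqj).ne', hq k hk]
        · simp only [ofLex_toLex, Finsupp.add_apply, Finsupp.single_apply, hqj.ne', if_false]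
          omega
    exact hlt'.not_ge (lexLe_iff_toLex.1 h)

lemma IsLppSet.isLppSet_shadow {L : Finset (Fin n →₀ ℕ)} (hL : IsLppSet hrn a d L) :
    IsLppSet hrn a (d + 1) (shadow hrn a d L) where
  deg u hu := (mem_shadow.1 hu).1
  pow u hu hp := mem_shadow.2 ⟨hu, Or.inl hp⟩
  up u hu hp w hw huw := by
    obtain ⟨hud, hup | ⟨v, hv, i, rfl⟩⟩ := mem_shadow.1 hu
    · exact absurd hup hp
    have hne : w.support.Nonempty := by
      rw [Finsupp.support_nonempty_iff]
      rintro rfl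
      simp [expDeg] at hw
    obtain ⟨w', hw'⟩ := exists_eq_add_single
      (Finsupp.mem_support_iff.1 (w.support.max'_mem hne))
    refine mem_shadow.2 ⟨hw, Or.inr ⟨w', ?_, _, hw'⟩⟩
    have hdeg : expDeg w' = d := by
      have := congrArg expDeg hw'
      rw [expDeg_add, expDeg_single] at this
      omega
    refine hL.up v hv (fun h => hp (h.mono le_self_add)) w' hdeg ?_
    refine lexLe_of_add_single ((hL.deg v hv).trans hdeg.symm)
      (j := w.support.max' hne) (fun k hk => ?_) (by rwa [hw'])
    have hk0 : w k = 0 := by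
      by_contra h0
      exact (w.support.le_max' k (Finsupp.mem_support_iff.2 h0)).not_gt hk
    rw [← hw', Finsupp.add_apply] at hk0
    omega

end LexPlusPowersSets

section LastVariable

variable {m r : ℕ}

/-- The exponent vector obtained by appending the exponent `k` of a new last variable. -/
noncomputable def snocExp (v : Fin m →₀ ℕ) (k : ℕ) : Fin (m + 1) →₀ ℕ :=
  Finsupp.equivFunOnFinite.symm (Fin.snoc v k)

@[simp] lemma snocExp_castSucc (v : Fin m →₀ ℕ) (k : ℕ) (i : Fin m) :
    snocExp v k i.castSucc = v i := by
  simp [snocExp]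

@[simp] lemma snocExp_last (v : Fin m →₀ ℕ) (k : ℕ) : snocExp v k (Fin.last m) = k := by
  simp [snocExp]

lemma snocExp_inj {v w : Fin m →₀ ℕ} {k l : ℕ} : snocExp v k = snocExp w l ↔ v = w ∧ k = l := by
  refine ⟨fun h => ⟨?_, ?_⟩, by rintro ⟨rfl, rfl⟩; rfl⟩
  · ext i
    simpa using DFunLike.congr_fun h i.castSucc
  · simpa using DFunLike.congr_fun h (Fin.last m)

lemma exists_eq_snocExp (u : Fin (m + 1) →₀ ℕ) : ∃ v, snocExp v (u (Fin.last m)) = u := by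
  refine ⟨Finsupp.equivFunOnFinite.symm fun i => u i.castSucc, ?_⟩
  ext i
  refine Fin.lastCases ?_ (fun i => ?_) i <;> simp

lemma expDeg_snocExp (v : Fin m →₀ ℕ) (k : ℕ) : expDeg (snocExp v k) = expDeg v + k := by
  simp [expDeg, Fin.sum_univ_castSucc]

lemma snocExp_add_single_castSucc (v : Fin m →₀ ℕ) (k : ℕ) (i : Fin m) :
    snocExp v k + Finsupp.single i.castSucc 1 = snocExp (v + Finsupp.single i 1) k := by
  ext j
  refine Fin.lastCases ?_ (fun j => ?_) j
  · simp [(Fin.castSucc_lt_last i).ne]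
  · simp [Finsupp.single_apply]

lemma hasPower_snocExp {hrm : r ≤ m} {hrm' : r ≤ m + 1} {a : Fin r → ℕ} {v : Fin m →₀ ℕ} {k : ℕ} :
    HasPower hrm' a (snocExp v k) ↔ HasPower hrm a v :=
  exists_congr fun i => by
    rw [show Fin.castLE hrm' i = (Fin.castLE hrm i).castSucc from rfl, snocExp_castSucc]

lemma hasPower_add_single_last (hrm : r ≤ m) {hrm' : r ≤ m + 1} {a : Fin r → ℕ}
    {u : Fin (m + 1) →₀ ℕ} (h : HasPower hrm' a (u + Finsupp.single (Fin.last m) 1)) :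
    HasPower hrm' a u := by
  refine h.imp fun i hi => ?_
  rwa [show Fin.castLE hrm' i = (Fin.castLE hrm i).castSucc from rfl, Finsupp.add_apply,
    Finsupp.single_eq_of_ne (Fin.castSucc_lt_last _).ne, add_zero] at hi

lemma lexLe_snocExp {v w : Fin m →₀ ℕ} (h : lexLe v w) (hne : v ≠ w) (k l : ℕ) :
    lexLe (snocExp v k) (snocExp w l) := by
  obtain rfl | ⟨i, hi, hlt⟩ := h
  · exact absurd rfl hne
  refine Or.inr ⟨i.castSucc, fun j hj => ?_, by simpa using hlt⟩
  obtain ⟨j, rfl⟩ := Fin.exists_castSucc_eq.2 (hj.trans (Fin.castSucc_lt_last i)).ne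
  simpa using hi j (by simpa using hj)

variable {hrm : r ≤ m} {hrm' : r ≤ m + 1} {a : Fin r → ℕ} {d : ℕ}
  {U : ℕ → Finset (Fin m →₀ ℕ)}

open Classical in
/-- The exponent vectors of the monomials `v * x ^ k`, with `v ∈ U k` and `x` the last variable. -/
noncomputable def snocUnion (U : ℕ → Finset (Fin m →₀ ℕ)) (d : ℕ) : Finset (Fin (m + 1) →₀ ℕ) :=
  (Finset.range (d + 1)).biUnion fun k => (U k).image (snocExp · k)

lemma snocExp_mem_snocUnion {v : Fin m →₀ ℕ} {k : ℕ} :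
    snocExp v k ∈ snocUnion U d ↔ k ≤ d ∧ v ∈ U k := by
  simp only [snocUnion, Finset.mem_biUnion, Finset.mem_image, Finset.mem_range, snocExp_inj]
  constructor
  · rintro ⟨_, hk, _, hv, rfl, rfl⟩
    exact ⟨by omega, hv⟩
  · rintro ⟨hk, hv⟩
    exact ⟨k, by omega, v, hv, rfl, rfl⟩

lemma card_snocUnion (U : ℕ → Finset (Fin m →₀ ℕ)) (d : ℕ) :
    (snocUnion U d).card = ∑ k ∈ Finset.range (d + 1), (U k).card := by
  classical
  rw [snocUnion, Finset.card_biUnion]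
  · exact Finset.sum_congr rfl fun k _ =>
      Finset.card_image_of_injective _ fun _ _ h => (snocExp_inj.1 h).1
  · intro k _ l _ hkl
    rw [Function.onFun, Finset.disjoint_left]
    intro u hu hu'
    obtain ⟨v, -, rfl⟩ := Finset.mem_image.1 hu
    obtain ⟨w, -, hw⟩ := Finset.mem_image.1 hu'
    exact hkl (snocExp_inj.1 hw).2.symm

/-- The lex-plus-powers set with as many elements as `snocUnion U d` has no more monomials free of
the last variable than `U 0`. -/
lemma mem_of_snocExp_zero_mem (hU : ∀ k ≤ d, IsLppSet hrm a (d - k) (U k))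
    (hmul : ∀ k < d, ∀ v ∈ U (k + 1), ∀ i, v + Finsupp.single i 1 ∈ U k)
    {L : Finset (Fin (m + 1) →₀ ℕ)} (hL : IsLppSet hrm' a d L)
    (hcard : L.card = (snocUnion U d).card) {u : Fin m →₀ ℕ} (hu : snocExp u 0 ∈ L) :
    u ∈ U 0 := by
  by_contra huU
  have hud : expDeg u = d := by simpa [expDeg_snocExp] using hL.deg _ hu
  have hup : ¬ HasPower hrm a u := fun hp => huU ((hU 0 (Nat.zero_le d)).pow u (by simpa) hp)
  have key : ∀ k ≤ d, ∀ v ∈ U k, ¬ HasPower hrm a v → ¬ lexLe v u := by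
    intro k
    induction k with
    | zero => exact fun hk v hv hvp hvu => huU ((hU 0 hk).up v hv hvp u (by simpa) hvu)
    | succ k ih =>
      intro hk v hv hvp hvu
      obtain ⟨j, hj, hju⟩ := exists_add_single_lexLe hup hvp
        (by rw [(hU _ hk).deg v hv]; omega) hvu
      exact ih (by omega) _ (hmul k (by omega) v hv j) hj hju
  have hsub : snocUnion U d ⊆ L := by
    intro w hw
    obtain ⟨v, hv⟩ := exists_eq_snocExp w
    rw [← hv] at hw ⊢
    obtain ⟨hk, hvU⟩ := snocExp_mem_snocUnion.1 hw
    have hdeg : expDeg (snocExp v (w (Fin.last m))) = d := by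
      rw [expDeg_snocExp, (hU _ hk).deg v hvU]
      omega
    by_cases hvp : HasPower hrm a v
    · exact hL.pow _ hdeg (hasPower_snocExp.2 hvp)
    · have hvu := key _ hk v hvU hvp
      refine hL.up _ hu (fun h => hup (hasPower_snocExp.1 h)) _ hdeg
        (lexLe_snocExp ((lexLe_total v u).resolve_left hvu) ?_ _ _)
      rintro rfl
      exact hvu (Or.inl rfl)
  rw [← Finset.eq_of_subset_of_card_le hsub hcard.le, snocExp_mem_snocUnion] at hu
  exact huU hu.2

lemma card_shadow_le {L : Finset (Fin (m + 1) →₀ ℕ)} {V : Finset (Fin m →₀ ℕ)}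
    (hL : IsLppSet hrm' a d L) (hV : IsLppSet hrm a (d + 1) V)
    (hLV : ∀ v, snocExp v 0 ∈ L → ∀ i, v + Finsupp.single i 1 ∈ V) :
    (shadow hrm' a d L).card ≤ L.card + V.card := by
  classical
  have hsub : shadow hrm' a d L ⊆
      L.image (· + Finsupp.single (Fin.last m) 1) ∪ V.image (snocExp · 0) := by
    intro u hu
    obtain ⟨hud, hu⟩ := mem_shadow.1 hu
    rw [Finset.mem_union, Finset.mem_image, Finset.mem_image]
    by_cases hlast : u (Fin.last m) = 0
    · right
      obtain ⟨u', hu'⟩ := exists_eq_snocExp u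
      rw [hlast] at hu'
      subst hu'
      refine ⟨u', ?_, rfl⟩
      rcases hu with hp | ⟨v, hv, i, hvi⟩
      · exact hV.pow u' (by simpa [expDeg_snocExp] using hud) (hasPower_snocExp.1 hp)
      · obtain ⟨v', hv'⟩ := exists_eq_snocExp v
        have hl := DFunLike.congr_fun hvi (Fin.last m)
        rw [Finsupp.add_apply, snocExp_last] at hl
        have hi : i ≠ Fin.last m := by
          rintro rfl
          simp at hl
        obtain ⟨i, rfl⟩ := Fin.exists_castSucc_eq.2 hi
        rw [show v (Fin.last m) = 0 by omega] at hv'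
        rw [← hv'] at hv hvi
        rw [snocExp_add_single_castSucc, snocExp_inj] at hvi
        exact hvi.1 ▸ hLV v' hv i
    · left
      obtain ⟨w, rfl⟩ := exists_eq_add_single hlast
      refine ⟨w, ?_, rfl⟩
      have hwd : expDeg w = d := by
        rw [expDeg_add, expDeg_single] at hud
        omega
      by_cases hwp : HasPower hrm' a w
      · exact hL.pow w hwd hwp
      rcases hu with hp | ⟨v, hv, i, hvi⟩
      · exact absurd (hasPower_add_single_last hrm hp) hwp
      · refine hL.up v hv (fun hvp => hwp (hasPower_add_single_last hrm ?_)) w hwd ?_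
        · exact hvi ▸ hvp.mono le_self_add
        · exact lexLe_of_add_single ((hL.deg v hv).trans hwd.symm)
            (fun k hk => absurd hk (Fin.le_last k).not_gt) (Or.inl hvi)
  calc _ ≤ _ := Finset.card_le_card hsub
    _ ≤ _ := Finset.card_union_le _ _
    _ ≤ _ := Nat.add_le_add Finset.card_image_le Finset.card_image_le

/-- A chain of lex-plus-powers sets closed under multiplication by variables yields a
lex-plus-powers set with one more variable and controlled growth. -/
lemma exists_isLppSet_of_chain (hrm' : r ≤ m + 1) {V : Finset (Fin m →₀ ℕ)}
    (hU : ∀ k ≤ d, IsLppSet hrm a (d - k) (U k))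
    (hmul : ∀ k < d, ∀ v ∈ U (k + 1), ∀ i, v + Finsupp.single i 1 ∈ U k)
    (hV : IsLppSet hrm a (d + 1) V) (hUV : ∀ v ∈ U 0, ∀ i, v + Finsupp.single i 1 ∈ V) :
    ∃ L, IsLppSet hrm' a d L ∧ L.card = ∑ k ∈ Finset.range (d + 1), (U k).card ∧
      (shadow hrm' a d L).card ≤ L.card + V.card := by
  classical
  have hS : snocUnion U d ⊆ monos (m + 1) d := by
    intro w hw
    obtain ⟨v, hv⟩ := exists_eq_snocExp w
    rw [← hv] at hw ⊢
    obtain ⟨hk, hvU⟩ := snocExp_mem_snocUnion.1 hw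
    rw [mem_monos, expDeg_snocExp, (hU _ hk).deg v hvU]
    omega
  have hpow : (monos (m + 1) d).filter (HasPower hrm' a) ⊆ snocUnion U d := by
    intro w hw
    obtain ⟨v, hv⟩ := exists_eq_snocExp w
    rw [← hv, Finset.mem_filter, mem_monos, expDeg_snocExp] at hw
    rw [← hv]
    have hk : w (Fin.last m) ≤ d := by omega
    exact snocExp_mem_snocUnion.2 ⟨hk, (hU _ hk).pow v (by omega) (hasPower_snocExp.1 hw.2)⟩
  obtain ⟨L, hL, hcard⟩ := exists_isLppSet_card_eq hrm' a hS (by convert hpow)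
  exact ⟨L, hL, hcard.trans (card_snocUnion U d), card_shadow_le hL hV fun v hv i =>
    hUV v (mem_of_snocExp_zero_mem hU hmul hL hcard hv) i⟩

end LastVariable

section MonomialIdeals

variable {K : Type*} [Field K] {n r : ℕ} {hrn : r ≤ n} {a : Fin r → ℕ}

lemma isHomogeneous_iff_expDeg {p : MvPolynomial (Fin n) K} {d : ℕ} :
    p.IsHomogeneous d ↔ ∀ u ∈ p.support, expDeg u = d := by
  simp only [IsHomogeneous, IsWeightedHomogeneous, mem_support_iff, expDeg_eq_degree,
    Finsupp.degree_eq_weight_one]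
  rfl

lemma component_restrictSupportIdeal {s : Set (Fin n →₀ ℕ)} (hs : IsUpperSet s) (d : ℕ) :
    component (restrictSupportIdeal K s hs) d = restrictSupport K {u | u ∈ s ∧ expDeg u = d} := by
  ext p
  rw [mem_component, isHomogeneous_iff_expDeg]
  change (↑p.support ⊆ s) ∧ _ ↔ ↑p.support ⊆ {u | u ∈ s ∧ expDeg u = d}
  exact ⟨fun h u hu => ⟨h.1 hu, h.2 u hu⟩, fun h => ⟨fun u hu => (h hu).1, fun u hu => (h hu).2⟩⟩

lemma isHomog_restrictSupportIdeal {s : Set (Fin n →₀ ℕ)} (hs : IsUpperSet s) :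
    IsHomog (restrictSupportIdeal K s hs) := by
  intro p hp d
  change ↑(homogeneousComponent d p).support ⊆ s
  intro u hu
  rw [Finset.mem_coe, mem_support_iff, coeff_homogeneousComponent, ite_ne_right_iff] at hu
  exact hp (mem_support_iff.2 hu.2)

lemma isUpperSet_hasPower : IsUpperSet {u : Fin n →₀ ℕ | HasPower hrn a u} :=
  fun _ _ huv h => h.mono huv

lemma purePowers_eq_restrictSupportIdeal :
    purePowers K hrn a = restrictSupportIdeal K {u | HasPower hrn a u} isUpperSet_hasPower := by
  refine le_antisymm (Ideal.span_le.2 ?_) fun p hp => ?_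
  · rintro _ ⟨i, rfl⟩
    change X (Fin.castLE hrn i) ^ a i ∈ restrictSupport K _
    rw [X_pow_eq_monomial]
    exact (monomial_mem_restrictSupport K).2 (Or.inl ⟨i, by simp⟩)
  · rw [p.as_sum]
    refine Ideal.sum_mem _ fun u hu => ?_
    obtain ⟨i, hi⟩ := hp hu
    have hle : Finsupp.single (Fin.castLE hrn i) (a i) ≤ u := by simpa using hi
    rw [← tsub_add_cancel_of_le hle, monomial_add_single]
    exact Ideal.mul_mem_left _ _ (Ideal.subset_span ⟨i, rfl⟩)

lemma component_purePowers (d : ℕ) : component (purePowers K hrn a) d =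
    restrictSupport K {u | HasPower hrn a u ∧ expDeg u = d} := by
  rw [purePowers_eq_restrictSupportIdeal, component_restrictSupportIdeal]
  rfl

lemma finrank_restrictSupport (U : Finset (Fin n →₀ ℕ)) :
    Module.finrank K (restrictSupport K (U : Set (Fin n →₀ ℕ))) = U.card := by
  rw [Module.finrank_eq_card_basis (basisRestrictSupport K (U : Set (Fin n →₀ ℕ)))]
  simp

lemma span_sup_component_purePowers (S : Set (Fin n →₀ ℕ)) (d : ℕ) :
    Submodule.span K ((fun m => (monomial m (1 : K) : MvPolynomial (Fin n) K)) '' S)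
      ⊔ component (purePowers K hrn a) d =
    restrictSupport K (S ∪ {u | HasPower hrn a u ∧ expDeg u = d}) := by
  rw [component_purePowers, restrictSupport_eq_span, restrictSupport_eq_span, Set.image_union,
    Submodule.span_union]

lemma IsLPP.exists_isLppSet {P : Ideal (MvPolynomial (Fin n) K)} (hP : IsLPP hrn a P) (d : ℕ) :
    ∃ U, IsLppSet hrn a d U ∧ component P d = restrictSupport K (U : Set (Fin n →₀ ℕ)) := by
  classical
  obtain ⟨S, ⟨hdeg, hup⟩, hS⟩ := hP.2 d
  refine ⟨(monos n d).filter fun u => u ∈ S ∨ HasPower hrn a u, ⟨?_, ?_, ?_⟩, ?_⟩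
  · exact fun u hu => mem_monos.1 (Finset.mem_filter.1 hu).1
  · exact fun u hu hp => Finset.mem_filter.2 ⟨mem_monos.2 hu, Or.inr hp⟩
  · exact fun u hu hp v hv huv => Finset.mem_filter.2 ⟨mem_monos.2 hv,
      Or.inl (hup u ((Finset.mem_filter.1 hu).2.resolve_right hp) v hv huv)⟩
  · rw [hS, span_sup_component_purePowers]
    congr 1
    ext u
    simp only [Set.mem_union, Set.mem_ofPred_eq, Finset.coe_filter, mem_monos]
    have := hdeg u
    tauto

/-- The combinatorial content of `EGHd`. -/
lemma EGHd.exists_isLppSet {I : Ideal (MvPolynomial (Fin n) K)} {d : ℕ} (h : EGHd hrn a I d) :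
    ∃ U V, IsLppSet hrn a d U ∧ IsLppSet hrn a (d + 1) V ∧ U.card = hilb I d ∧
      V.card ≤ hilb I (d + 1) ∧ ∀ u ∈ U, ∀ i, u + Finsupp.single i 1 ∈ V := by
  obtain ⟨P, hP, h1, h2⟩ := h
  obtain ⟨U, hU, hPU⟩ := hP.exists_isLppSet d
  obtain ⟨V, hV, hPV⟩ := hP.exists_isLppSet (d + 1)
  rw [hilb, hPU, finrank_restrictSupport] at h1
  rw [hilb, hPV, finrank_restrictSupport] at h2
  refine ⟨U, V, hU, hV, h1, h2, fun u hu i => ?_⟩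
  have hmem : (monomial u (1 : K)) ∈ component P d := by
    rw [hPU]
    exact (monomial_mem_restrictSupport K).2 (Or.inl hu)
  have hmem' : (monomial (u + Finsupp.single i 1) (1 : K)) ∈ component P (d + 1) := by
    rw [mem_component] at hmem ⊢
    rw [monomial_add_single, pow_one]
    exact ⟨Ideal.mul_mem_right _ _ hmem.1, hmem.2.mul (isHomogeneous_X K i)⟩
  rw [hPV] at hmem'
  exact ((monomial_mem_restrictSupport K).1 hmem').resolve_right one_ne_zero

lemma isUpperSet_of_add_single {s : Set (Fin n →₀ ℕ)}
    (hs : ∀ u ∈ s, ∀ i, u + Finsupp.single i 1 ∈ s) : IsUpperSet s := by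
  intro u v huv hu
  obtain ⟨w, rfl⟩ := exists_add_of_le huv
  clear huv
  induction w using Finsupp.induction_linear generalizing u with
  | zero => simpa using hu
  | add w w' hw hw' => exact add_assoc u w w' ▸ hw' (hw hu)
  | single i k =>
    induction k with
    | zero => simpa using hu
    | succ k ih => exact Finsupp.single_add i k 1 ▸ add_assoc u _ _ ▸ hs _ ih i

lemma exists_isLPP_of_isLppSet {W : ℕ → Finset (Fin n →₀ ℕ)} (hW : ∀ d, IsLppSet hrn a d (W d))
    (hmul : ∀ d, ∀ u ∈ W d, ∀ i, u + Finsupp.single i 1 ∈ W (d + 1)) :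
    ∃ P : Ideal (MvPolynomial (Fin n) K), IsLPP hrn a P ∧ ∀ d, hilb P d = (W d).card := by
  have hs : IsUpperSet {u | u ∈ W (expDeg u)} := isUpperSet_of_add_single fun u hu i => by
    change _ ∈ W (expDeg _)
    rw [expDeg_add, expDeg_single]
    exact hmul _ u hu i
  have hcomp : ∀ d, component (restrictSupportIdeal K _ hs) d =
      restrictSupport K (W d : Set (Fin n →₀ ℕ)) := by
    intro d
    rw [component_restrictSupportIdeal]
    congr 1
    ext u
    exact ⟨fun h => h.2 ▸ h.1, fun h => ⟨by simpa [(hW d).deg u h] using h, (hW d).deg u h⟩⟩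
  refine ⟨restrictSupportIdeal K _ hs, ⟨isHomog_restrictSupportIdeal hs, fun d => ?_⟩,
    fun d => by rw [hilb, hcomp, finrank_restrictSupport]⟩
  refine ⟨{v | expDeg v = d ∧ ∃ u ∈ W d, ¬ HasPower hrn a u ∧ lexLe u v},
    ⟨fun v hv => hv.1, ?_⟩, ?_⟩
  · rintro v ⟨-, u, hu, hp, huv⟩ w hw hvw
    exact ⟨hw, u, hu, hp, lexLe_trans huv hvw⟩
  · rw [hcomp, span_sup_component_purePowers]
    congr 1
    ext v
    constructor
    · intro hv
      by_cases hp : HasPower hrn a v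
      · exact Or.inr ⟨hp, (hW d).deg v hv⟩
      · exact Or.inl ⟨(hW d).deg v hv, v, hv, hp, Or.inl rfl⟩
    · rintro (⟨hv, u, hu, hp, huv⟩ | ⟨hp, hv⟩)
      · exact (hW d).up u hu hp v hv huv
      · exact (hW d).pow v hv hp

open Classical in
lemma isLppSet_filter_hasPower (d : ℕ) :
    IsLppSet hrn a d ((monos n d).filter (HasPower hrn a)) where
  deg _ hu := mem_monos.1 (Finset.mem_filter.1 hu).1
  pow _ hu hp := Finset.mem_filter.2 ⟨mem_monos.2 hu, hp⟩
  up _ hu hp := absurd (Finset.mem_filter.1 hu).2 hp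

lemma isLppSet_monos (d : ℕ) : IsLppSet hrn a d (monos n d) where
  deg _ hu := mem_monos.1 hu
  pow _ hu _ := mem_monos.2 hu
  up _ _ _ _ hv _ := mem_monos.2 hv

variable (K) in
lemma IsLppSet.exists_isLPP {L : Finset (Fin n →₀ ℕ)} {d : ℕ} (hL : IsLppSet hrn a d L) :
    ∃ P : Ideal (MvPolynomial (Fin n) K), IsLPP hrn a P ∧ hilb P d = L.card ∧
      hilb P (d + 1) = (shadow hrn a d L).card := by
  classical
  let W : ℕ → Finset (Fin n →₀ ℕ) := fun e =>
    if e < d then (monos n e).filter (HasPower hrn a) else if e = d then L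
    else if e = d + 1 then shadow hrn a d L else monos n e
  have hWd : W d = L := by simp [W]
  have hWd' : W (d + 1) = shadow hrn a d L := by simp [W]
  have hW : ∀ e, IsLppSet hrn a e (W e) := by
    intro e
    dsimp only [W]
    split_ifs with h1 h2 h3
    · exact isLppSet_filter_hasPower e
    · exact h2 ▸ hL
    · exact h3 ▸ hL.isLppSet_shadow
    · exact isLppSet_monos e
  obtain ⟨P, hP, hcard⟩ := exists_isLPP_of_isLppSet (K := K) hW fun e u hu i => by
    have hdeg : expDeg (u + Finsupp.single i 1) = e + 1 := by
      rw [expDeg_add, expDeg_single, (hW e).deg u hu]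
    by_cases h1 : e < d
    · have hp : HasPower hrn a u := by
        simp only [W, if_pos h1, Finset.mem_filter] at hu
        exact hu.2
      exact (hW (e + 1)).pow _ hdeg (hp.mono le_self_add)
    by_cases h2 : e = d
    · subst h2
      rw [hWd] at hu
      rw [hWd']
      exact mem_shadow.2 ⟨hdeg, Or.inr ⟨u, hu, i, rfl⟩⟩
    · have : W (e + 1) = monos n (e + 1) := by
        simp only [W]
        rw [if_neg (by omega), if_neg (by omega), if_neg (by omega)]
      rw [this]
      exact mem_monos.2 hdeg
  exact ⟨P, hP, by rw [hcard, hWd], by rw [hcard, hWd']⟩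

end MonomialIdeals

section StableChains

variable {K : Type*} [Field K] {m r : ℕ} {hrm : r ≤ m} {a : Fin r → ℕ}
  {F : Ideal (MvPolynomial (Fin m) K)}

/-- If every homogeneous ideal containing `F` satisfies EGH, then the Hilbert function of a chain
of such ideals is bounded below by that of a lex-plus-powers ideal in one more variable. -/
lemma exists_isLPP_of_chain (hrm' : r ≤ m + 1) {J : ℕ → Ideal (MvPolynomial (Fin m) K)}
    (hF : ∀ N : Ideal (MvPolynomial (Fin m) K), IsHomog N → F ≤ N → EGH hrm a N)
    (hJ : IsIdealChain F J) (d : ℕ) :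
    ∃ P : Ideal (MvPolynomial (Fin (m + 1)) K), IsLPP hrm' a P ∧
      hilb P d = chainHilb J d (d + 1) ∧ hilb P (d + 1) ≤ chainHilb J (d + 1) (d + 2) := by
  obtain ⟨J', hJ', hilb_eq, hX⟩ := exists_stable_chain hJ d
  rw [← hilb_eq d, ← hilb_eq (d + 1)]
  have hU : ∀ k, ∃ U V, IsLppSet hrm a (d - k) U ∧ IsLppSet hrm a (d - k + 1) V ∧
      U.card = hilb (J' k) (d - k) ∧ V.card ≤ hilb (J' k) (d - k + 1) ∧
      ∀ u ∈ U, ∀ i, u + Finsupp.single i 1 ∈ V := fun k =>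
    (hF _ (hJ'.isHomog k) (hJ'.le k) (d - k)).exists_isLppSet
  choose U V hU hV hUcard hVcard hUV using hU
  have hmul : ∀ k < d, ∀ v ∈ U (k + 1), ∀ i, v + Finsupp.single i 1 ∈ U k := by
    intro k hk v hv i
    obtain ⟨N, hN, hle, hN1, hN2⟩ := exists_ideal_of_X_mul_mem (hJ'.le_succ k) (hJ'.isHomog k)
      (d - (k + 1)) (hX k hk)
    obtain ⟨U', V', hU', hV', hUcard', hVcard', hUV'⟩ :=
      (hF N hN ((hJ'.le k).trans hle) (d - (k + 1))).exists_isLppSet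
    rw [hilb, hN1, ← hilb, ← hUcard] at hUcard'
    rw [hilb, hN2, ← hilb] at hVcard'
    have hd : d - (k + 1) + 1 = d - k := by omega
    rw [hd] at hVcard' hV'
    rw [← hUcard] at hVcard'
    exact hV'.subset_of_card_le (hU k) hVcard'
      (hUV' v ((hU (k + 1)).subset_of_card_le hU' hUcard'.ge hv) i)
  obtain ⟨L, hL, hLcard, hshadow⟩ := exists_isLppSet_of_chain hrm' (fun k _ => hU k) hmul
    (hV 0) (hUV 0)
  obtain ⟨P, hP, hP1, hP2⟩ := hL.exists_isLPP K
  have hLd : L.card = chainHilb J' d (d + 1) := by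
    rw [hLcard, chainHilb]
    exact Finset.sum_congr rfl fun k _ => hUcard k
  refine ⟨P, hP, hP1.trans hLd, hP2.le.trans (hshadow.trans ?_)⟩
  rw [hLd, chainHilb, chainHilb, Finset.sum_range_succ' _ (d + 1)]
  refine Nat.add_le_add (Finset.sum_le_sum fun k _ => ?_) (hVcard 0)
  rw [Nat.add_sub_add_right]
  exact hilb_mono (hJ'.le_succ k) _

end StableChains

/-- **Artinian reduction.** Let `f` be an ideal of `A = K[x_1,…,x_{m+1}]` generated by a
homogeneous regular sequence of degree `a`, and let `ℓ` be a linear form regular on `A/f`.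
Identify `Ā = A/(ℓ)` with `K[x_1,…,x_m]` via any graded `K`-algebra surjection `φ` with
kernel `(ℓ)`.  If every homogeneous ideal of `Ā` containing `f̄ = φ(f)Ā` satisfies `EGH_a`,
then every homogeneous ideal of `A` containing `f` satisfies `EGH_a`. -/
theorem artinian_reduction {K : Type*} [Field K] {m r : ℕ} (hrm : r ≤ m)
    (a : Fin r → ℕ) (hpos : ∀ i, 0 < a i) (hmono : Monotone a)
    (f : Fin r → MvPolynomial (Fin (m + 1)) K)
    (hreg : IsRegSeq f) (hdeg : ∀ i, (f i).IsHomogeneous (a i))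
    (ℓ : MvPolynomial (Fin (m + 1)) K) (hℓ1 : ℓ.IsHomogeneous 1)
    (hℓreg : ∀ g : MvPolynomial (Fin (m + 1)) K,
      g * ℓ ∈ Ideal.span (Set.range f) → g ∈ Ideal.span (Set.range f))
    (φ : MvPolynomial (Fin (m + 1)) K →ₐ[K] MvPolynomial (Fin m) K)
    (hφsurj : Function.Surjective φ)
    (hφgr : ∀ i : Fin (m + 1), (φ (X i)).IsHomogeneous 1)
    (hker : RingHom.ker φ = Ideal.span {ℓ})
    (hyp : ∀ I' : Ideal (MvPolynomial (Fin m) K), IsHomog I' →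
      Ideal.map φ (Ideal.span (Set.range f)) ≤ I' → EGH hrm a I') :
    ∀ I : Ideal (MvPolynomial (Fin (m + 1)) K), IsHomog I →
      Ideal.span (Set.range f) ≤ I → EGH (hrm.trans (Nat.le_succ m)) a I := by
  intro I hI hfI d
  have hℓ0 : ℓ ≠ 0 := by
    rintro rfl
    have h1 : (1 : MvPolynomial (Fin (m + 1)) K) ∈ Ideal.span (Set.range f) :=
      hℓreg 1 (by rw [mul_zero]; exact zero_mem _)
    have hle : Ideal.span (Set.range f) ≤ RingHom.ker (constantCoeff (R := K)) := by
      rw [Ideal.span_le]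
      rintro _ ⟨i, rfl⟩
      exact (hdeg i).coeff_eq_zero (by simpa using (hpos i).ne)
    simpa using hle h1
  have hJ := imageChain_isIdealChain hφgr hφsurj hℓ1 hI hfI
  obtain ⟨P, hP, h1, h2⟩ := exists_isLPP_of_chain (hrm.trans (Nat.le_succ m)) hyp hJ d
  rw [← hilb_eq_chainHilb hφgr hφsurj hℓ1 hℓ0 hker hI] at h1 h2
  exact ⟨P, hP, h1, h2⟩
end
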